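/- arXiv:2604.00591 — 4 statements merged into one kernel-verified Lean document; each statement's English description precedes it below -/
import Mathlib

section
/- For every integer q ≥ 2, the constant c(q) := ∏_{i=1}^∞ (1 − q^{−i}) satisfies c(q)^q ≥ exp(−1 − 3/(2q) − 29/(9q²)) ≥ e^{−23/9}, and consequently q·c(q)^q/(q−1) ≥ e^{−23/9}. -/
open Filter

lemma prod_one_sub_pow_bounds (x : ℝ) (h0 : 0 ≤ x) (h1 : x ≤ 1) (n : ℕ) :
    (1 - x ^ 2) * (1 - x - x ^ 3 + x ^ (n + 3)) ≤ ∏ i ∈ Finset.Icc 1 (n + 2), (1 - x ^ i) ∧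
    ∏ i ∈ Finset.Icc 1 (n + 2), (1 - x ^ i) ≤ (1 - x) * (1 - x ^ 2) := by
  induction n with
  | zero =>
    have h : ∏ i ∈ Finset.Icc 1 (0 + 2), (1 - x ^ i) = (1 - x) * (1 - x ^ 2) := by
      rw [Finset.prod_Icc_succ_top (by norm_num)]
      simp
    rw [h]
    constructor <;> apply le_of_eq <;> ring
  | succ n ih =>
    obtain ⟨hl, hu⟩ := ih
    rw [show n + 1 + 2 = n + 2 + 1 by ring, Finset.prod_Icc_succ_top (by lia)]
    have hp : 0 ≤ x ^ (n + 3) := by positivity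
    have hm := mul_le_mul_of_nonneg_right hu hp
    have hnn : 0 ≤ ∏ i ∈ Finset.Icc 1 (n + 2), (1 - x ^ i) :=
      Finset.prod_nonneg fun i _ => sub_nonneg.2 (pow_le_one₀ h0 h1)
    have hnm := mul_nonneg hnn hp
    constructor
    · rw [show n + 2 + 1 = n + 3 by ring, show n + 1 + 3 = (n + 3) + 1 by ring, pow_succ x (n + 3)]
      linarith
    · rw [show n + 2 + 1 = n + 3 by ring]
      linarith

lemma exp_neg_cubic_le (q : ℝ) (hq : 2 ≤ q) :
    Real.exp (-(q⁻¹ + 3 / 2 * q⁻¹ ^ 2 + 29 / 9 * q⁻¹ ^ 3)) ≤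
      (1 - q⁻¹ ^ 2) * (1 - q⁻¹ - q⁻¹ ^ 3) := by
  obtain ⟨y, hy, rfl⟩ : ∃ y : ℝ, 0 ≤ y ∧ q = y + 2 := ⟨q - 2, by linarith, by ring⟩
  set t : ℝ := (y + 2)⁻¹ + 3 / 2 * (y + 2)⁻¹ ^ 2 + 29 / 9 * (y + 2)⁻¹ ^ 3 with ht
  set p : ℝ := (1 - (y + 2)⁻¹ ^ 2) * (1 - (y + 2)⁻¹ - (y + 2)⁻¹ ^ 3) with hp
  have hp0 : 0 ≤ p := by
    have : p = ((y + 2) ^ 2 - 1) * ((y + 2) ^ 3 - (y + 2) ^ 2 - 1) / (y + 2) ^ 5 := by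
      rw [hp]; field_simp
    rw [this, show (y + 2) ^ 2 - 1 = y ^ 2 + 4 * y + 3 by ring,
      show (y + 2) ^ 3 - (y + 2) ^ 2 - 1 = y ^ 3 + 5 * y ^ 2 + 8 * y + 3 by ring]
    positivity
  have hexp : ∑ i ∈ Finset.range 7, t ^ i / (i.factorial : ℝ) ≤ Real.exp t :=
    Real.sum_le_exp_of_nonneg (by positivity) 7
  have key : 1 ≤ (∑ i ∈ Finset.range 7, t ^ i / (i.factorial : ℝ)) * p := by
    rw [← sub_nonneg, ht, hp]
    simp only [Finset.sum_range_succ, Finset.sum_range_zero, Nat.factorial]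
    push_cast
    field_simp
    ring_nf
    positivity
  rw [Real.exp_neg, inv_le_iff_one_le_mul₀' (Real.exp_pos t)]
  exact key.trans (mul_le_mul_of_nonneg_right hexp hp0)

/-- For every integer `q ≥ 2`, the constant `c(q) := ∏_{i=1}^∞ (1 − q^{−i})` satisfies
`c(q)^q ≥ exp(−1 − 3/(2q) − 29/(9q²)) ≥ e^{−23/9}`, and consequently
`q·c(q)^q/(q−1) ≥ e^{−23/9}`. -/
theorem stmt_1 (q : ℕ) (hq : 2 ≤ q) (c : ℝ)
    (hc : Tendsto (fun n : ℕ => ∏ i ∈ Finset.Icc 1 n, (1 - ((q : ℝ))⁻¹ ^ i)) atTop (nhds c)) :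
    c ^ q ≥ Real.exp (-1 - 3 / (2 * (q : ℝ)) - 29 / (9 * (q : ℝ) ^ 2)) ∧
    Real.exp (-1 - 3 / (2 * (q : ℝ)) - 29 / (9 * (q : ℝ) ^ 2)) ≥ Real.exp (-23 / 9) ∧
    (q : ℝ) * c ^ q / ((q : ℝ) - 1) ≥ Real.exp (-23 / 9) := by
  have hq' : (2 : ℝ) ≤ q := by exact_mod_cast hq
  have hx0 : (0 : ℝ) ≤ (q : ℝ)⁻¹ := by positivity
  have hx1 : (q : ℝ)⁻¹ ≤ 1 := inv_le_one_of_one_le₀ (by linarith)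
  have hc_ge : (1 - (q : ℝ)⁻¹ ^ 2) * (1 - (q : ℝ)⁻¹ - (q : ℝ)⁻¹ ^ 3) ≤ c := by
    refine ge_of_tendsto' ((tendsto_add_atTop_iff_nat 2).2 hc) fun n => le_trans ?_
      (prod_one_sub_pow_bounds _ hx0 hx1 n).1
    have h2 : 0 ≤ 1 - (q : ℝ)⁻¹ ^ 2 := sub_nonneg.2 (pow_le_one₀ hx0 hx1)
    exact mul_le_mul_of_nonneg_left (le_add_of_nonneg_right (by positivity)) h2
  have hfirst : Real.exp (-1 - 3 / (2 * (q : ℝ)) - 29 / (9 * (q : ℝ) ^ 2)) ≤ c ^ q := by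
    have h := pow_le_pow_left₀ (Real.exp_pos _).le
      ((exp_neg_cubic_le q hq').trans hc_ge) q
    rw [← Real.exp_nat_mul] at h
    refine le_of_eq_of_le (congrArg Real.exp ?_) h
    field_simp
    ring
  have hsecond : Real.exp (-23 / 9) ≤
      Real.exp (-1 - 3 / (2 * (q : ℝ)) - 29 / (9 * (q : ℝ) ^ 2)) := by
    have h1 : 3 / (2 * (q : ℝ)) ≤ 3 / (2 * 2) := by gcongr
    have h2 : 29 / (9 * (q : ℝ) ^ 2) ≤ 29 / (9 * 2 ^ 2) := by gcongr
    apply Real.exp_le_exp.2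
    linarith
  refine ⟨hfirst, hsecond, ?_⟩
  have hcq := hsecond.trans hfirst
  have hpos := Real.exp_pos (-23 / 9)
  rw [ge_iff_le, le_div_iff₀ (by linarith)]
  nlinarith
end

section
/- Let q be a prime power, n ≥ 0, and let m : F_q → ℕ be a function with D(m) := Σ_{λ∈F_q} m(λ) ≤ n, and set r := n − D(m). Then |C_m(n, q)| = |GL(n, q)| · v(GL, r, q) · ∏_{λ∈F_q} q^{m(λ)² − m(λ)} / |GL(m(λ), q)|, where C_m(n, q) is the set of matrices A ∈ M(n, F_q) whose characteristic polynomial factors as c_A(t) = f₀(t)·∏_{λ∈F_q}(t − λ)^{m(λ)} with f₀ ∈ F_q[t] monic of degree r having no roots in F_q. -/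
open Matrix Polynomial

/-- `v(GL, r, q)`: the proportion of eigenvalue-free matrices (characteristic polynomial with
no roots in `F`) in `GL(r, F)`.  (For `r = 0` this equals `1`.) -/
noncomputable def vGL (F : Type*) [Field F] [Fintype F] (r : ℕ) : ℝ :=
  (Nat.card {A : (Matrix (Fin r) (Fin r) F)ˣ //
      ∀ t : F, ((A.val : Matrix (Fin r) (Fin r) F).charpoly).eval t ≠ 0} : ℝ)
    / (Nat.card (Matrix (Fin r) (Fin r) F)ˣ : ℝ)

open Module in
theorem LinearMap.comp_aeval_of_comp_eq {R M N : Type*} [CommRing R] [AddCommGroup M] [Module R M]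
    [AddCommGroup N] [Module R N] {f : End R M} {g : End R N} {h : M →ₗ[R] N}
    (hfg : h ∘ₗ f = g ∘ₗ h) (p : R[X]) : h ∘ₗ aeval f p = aeval g p ∘ₗ h := by
  have hfg' (x : M) : h (f x) = g (h x) := LinearMap.congr_fun hfg x
  induction p using Polynomial.induction_on' with
  | add p q hp hq => simp [LinearMap.comp_add, LinearMap.add_comp, hp, hq]
  | monomial k c =>
    have hk : ∀ x, h ((f ^ k) x) = (g ^ k) (h x) := by
      induction k with
      | zero => simp
      | succ k ih => intro x; simp [pow_succ, ih, hfg']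
    ext x
    simp [aeval_monomial, hk]

theorem Matrix.mul_aeval_of_mul_eq {R m n : Type*} [CommRing R] [Fintype m] [DecidableEq m]
    [Fintype n] [DecidableEq n] {B : Matrix m m R} {D : Matrix n n R} {Y : Matrix m n R}
    (h : Y * D = B * Y) (p : R[X]) : Y * aeval D p = aeval B p * Y := by
  induction p using Polynomial.induction_on' with
  | add p q hp hq => simp [Matrix.mul_add, Matrix.add_mul, hp, hq]
  | monomial k c =>
    have hk : Y * D ^ k = B ^ k * Y := by
      induction k with
      | zero => simp
      | succ k ih => rw [pow_succ, ← Matrix.mul_assoc, ih, Matrix.mul_assoc, h, ← Matrix.mul_assoc,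
          ← pow_succ]
    simp [aeval_monomial, ← Algebra.smul_def, hk]

theorem Polynomial.isUnit_aeval_of_isCoprime {R A : Type*} [CommRing R] [Ring A] [Algebra R A]
    {a : A} {p q : R[X]} (hpq : IsCoprime p q) (ha : aeval a p = 0) : IsUnit (aeval a q) := by
  obtain ⟨u, v, huv⟩ := hpq
  have h : aeval a v * aeval a q = 1 := by
    simpa [ha] using congrArg (aeval a) huv
  have h' : aeval a q * aeval a v = 1 := by rw [← map_mul, mul_comm, map_mul, h]
  exact ⟨⟨_, _, h', h⟩, rfl⟩

theorem Matrix.isCoprime_charpoly_of_isUnit_aeval {K n : Type*} [Field K] [Fintype n]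
    [DecidableEq n] {A : Matrix n n K} {q : K[X]} (h : IsUnit (aeval A q)) :
    IsCoprime A.charpoly q := by
  refine (Polynomial.isCoprime_iff_aeval_ne_zero_of_isAlgClosed K (AlgebraicClosure K) _ _).2
    fun a => ?_
  by_contra! ha
  let φ := (Algebra.ofId K (AlgebraicClosure K)).mapMatrix (m := n)
  have hφ : φ A = A.map (algebraMap K (AlgebraicClosure K)) := rfl
  have hroot : a ∈ spectrum (AlgebraicClosure K) (φ A) := by
    rw [Matrix.mem_spectrum_iff_isRoot_charpoly, hφ, Matrix.charpoly_map, IsRoot, eval_map_algebraMap]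
    exact ha.1
  have h0 := spectrum.subset_polynomial_aeval (φ A) (q.map (algebraMap K (AlgebraicClosure K)))
    ⟨a, hroot, rfl⟩
  simp only [eval_map_algebraMap, ha.2, aeval_map_algebraMap, aeval_algHom_apply] at h0
  exact spectrum.zero_notMem _ (h.map φ) h0

open Module in
theorem LinearMap.isCoprime_charpoly_of_aeval_eq_zero {K M : Type*} [Field K] [AddCommGroup M]
    [Module K M] [FiniteDimensional K M] {f : End K M} {p q : K[X]} (hpq : IsCoprime p q)
    (hf : aeval f p = 0) : IsCoprime f.charpoly q := by
  have b := finBasis K M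
  rw [← LinearMap.charpoly_toMatrix f b]
  refine Matrix.isCoprime_charpoly_of_isUnit_aeval (Polynomial.isUnit_aeval_of_isCoprime hpq ?_)
  have : aeval (LinearMap.toMatrixAlgEquiv b f) p = 0 := by
    rw [aeval_algHom_apply, hf, map_zero]
  exact this

theorem Polynomial.Monic.eq_and_eq_of_mul_eq_mul {K : Type*} [Field K] {p q p' q' : K[X]}
    (hp : p.Monic) (hp' : p'.Monic) (h : p * q = p' * q')
    (h₁ : IsCoprime p q') (h₂ : IsCoprime p' q) : p = p' ∧ q = q' := by
  have e : p = p' := eq_of_monic_of_associated hp hp' <| associated_of_dvd_dvd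
    (h₁.dvd_of_dvd_mul_right (h ▸ dvd_mul_right p q))
    (h₂.dvd_of_dvd_mul_right (h ▸ dvd_mul_right p' q'))
  exact ⟨e, mul_left_cancel₀ hp.ne_zero (by rw [h, e])⟩

open Module in
theorem Matrix.exists_eq_conj_fromBlocks_of_charpoly_eq_mul {K n : Type*} [Field K] [Fintype n]
    [DecidableEq n] {a b : ℕ} (A : Matrix n n K) {p q : K[X]} (hp : p.Monic)
    (hpa : p.natDegree = a) (hqb : q.natDegree = b) (hpq : IsCoprime p q)
    (hA : A.charpoly = p * q) :
    ∃ (P : Matrix n (Fin a ⊕ Fin b) K) (Q : Matrix (Fin a ⊕ Fin b) n K)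
      (B : Matrix (Fin a) (Fin a) K) (D : Matrix (Fin b) (Fin b) K),
      P * Q = 1 ∧ Q * P = 1 ∧ A = P * fromBlocks B 0 0 D * Q ∧
      B.charpoly = p ∧ D.charpoly = q := by
  let f : End K (n → K) := toLin' A
  have hf : aeval f (p * q) = 0 := by
    rw [← hA]
    have : aeval (toLinAlgEquiv' A) A.charpoly = 0 := by
      rw [aeval_algHom_apply, aeval_self_charpoly, map_zero]
    exact this
  let V := LinearMap.ker (aeval f p)
  let W := LinearMap.ker (aeval f q)
  have hVW : IsCompl V W := ⟨disjoint_ker_aeval_of_isCoprime f hpq, codisjoint_iff.2 <| by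
    rw [sup_ker_aeval_eq_ker_aeval_mul_of_coprime f hpq, hf, LinearMap.ker_zero]⟩
  have hinv (r : K[X]) : ∀ x ∈ LinearMap.ker (aeval f r), f x ∈ LinearMap.ker (aeval f r) := by
    intro x hx
    have := LinearMap.congr_fun (LinearMap.comp_aeval_of_comp_eq (f := f) (g := f) (h := f) rfl r) x
    simp only [LinearMap.comp_apply, LinearMap.mem_ker.1 hx, map_zero] at this
    exact LinearMap.mem_ker.2 this.symm
  have hann (r : K[X]) : aeval (f.restrict (hinv r)) r = 0 := by
    ext x : 2
    have := LinearMap.congr_fun (LinearMap.comp_aeval_of_comp_eq (f := f.restrict (hinv r))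
      (g := f) (h := (LinearMap.ker (aeval f r)).subtype) rfl r) x
    simpa using this
  let F := f.restrict (hinv p)
  let G := f.restrict (hinv q)
  let e := Submodule.prodEquivOfIsCompl V W hVW
  have hconj : F.prodMap G = e.symm.conj f := by
    apply LinearMap.ext
    rintro ⟨x, y⟩
    rw [LinearEquiv.conj_apply, LinearMap.comp_apply, LinearMap.comp_apply]
    simp only [LinearEquiv.coe_coe, LinearEquiv.symm_symm]
    rw [LinearEquiv.eq_symm_apply]
    simp [e, F, G]
  have hchar : F.charpoly * G.charpoly = p * q := by
    rw [← LinearMap.charpoly_prodMap, hconj, LinearEquiv.charpoly_conj, ← hA]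
    exact Matrix.charpoly_toLin' A
  obtain ⟨hFp, hGq⟩ := Polynomial.Monic.eq_and_eq_of_mul_eq_mul F.charpoly_monic
    hp hchar (LinearMap.isCoprime_charpoly_of_aeval_eq_zero hpq (hann p))
    (LinearMap.isCoprime_charpoly_of_aeval_eq_zero hpq.symm (hann q)).symm
  let bV : Basis (Fin a) K V := finBasisOfFinrankEq K V (by
    rw [← hpa, ← hFp, LinearMap.charpoly_natDegree])
  let bW : Basis (Fin b) K W := finBasisOfFinrankEq K W (by
    rw [← hqb, ← hGq, LinearMap.charpoly_natDegree])
  let β : Basis (Fin a ⊕ Fin b) K (n → K) := (bV.prod bW).map e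
  refine ⟨(Pi.basisFun K n).toMatrix β, β.toMatrix (Pi.basisFun K n), LinearMap.toMatrix bV bV F,
    LinearMap.toMatrix bW bW G, Basis.toMatrix_mul_toMatrix_flip .., Basis.toMatrix_mul_toMatrix_flip ..,
    ?_, by rw [LinearMap.charpoly_toMatrix, hFp], by rw [LinearMap.charpoly_toMatrix, hGq]⟩
  have hblock : fromBlocks (LinearMap.toMatrix bV bV F) 0 0 (LinearMap.toMatrix bW bW G)
      = LinearMap.toMatrix β β f := by
    rw [← LinearMap.toMatrix_prodMap, hconj]
    ext i j
    simp [LinearMap.toMatrix_apply, β, LinearEquiv.conj_apply]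
  rw [hblock, basis_toMatrix_mul_linearMap_toMatrix_mul_basis_toMatrix,
    LinearMap.toMatrix_eq_toMatrix']
  simp [f]

theorem Matrix.eq_zero_of_mul_eq_mul_of_isCoprime_charpoly {K m n : Type*} [Field K] [Fintype m]
    [DecidableEq m] [Fintype n] [DecidableEq n] {B : Matrix m m K} {D : Matrix n n K}
    {Y : Matrix m n K} (h : Y * D = B * Y) (hc : IsCoprime B.charpoly D.charpoly) : Y = 0 := by
  have hY := Matrix.mul_aeval_of_mul_eq h D.charpoly
  rw [aeval_self_charpoly, Matrix.mul_zero] at hY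
  obtain ⟨u, hu⟩ := Polynomial.isUnit_aeval_of_isCoprime hc (aeval_self_charpoly B)
  rw [← hu] at hY
  calc Y = u⁻¹.val * (u.val * Y) := by rw [← Matrix.mul_assoc, u.inv_mul, Matrix.one_mul]
    _ = 0 := by rw [← hY, Matrix.mul_zero]

/-- The block diagonal invertible matrix with two given invertible diagonal blocks. -/
def Matrix.blockUnits {R m n : Type*} [CommRing R] [Fintype m] [DecidableEq m] [Fintype n]
    [DecidableEq n] (u : (Matrix m m R)ˣ) (v : (Matrix n n R)ˣ) : (Matrix (m ⊕ n) (m ⊕ n) R)ˣ where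
  val := fromBlocks u 0 0 v
  inv := fromBlocks ↑u⁻¹ 0 0 ↑v⁻¹
  val_inv := by simp [fromBlocks_multiply]
  inv_val := by simp [fromBlocks_multiply]

theorem Matrix.exists_eq_blockUnits_of_mul_eq {K m n : Type*} [Field K] [Fintype m] [DecidableEq m]
    [Fintype n] [DecidableEq n] {B B' : Matrix m m K} {D D' : Matrix n n K}
    (h : (Matrix (m ⊕ n) (m ⊕ n) K)ˣ)
    (hh : h.val * fromBlocks B 0 0 D = fromBlocks B' 0 0 D' * h.val)
    (h₁ : IsCoprime B'.charpoly D.charpoly) (h₂ : IsCoprime B.charpoly D'.charpoly) :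
    ∃ u v, h = blockUnits u v ∧ u.val * B = B' * u.val ∧ v.val * D = D' * v.val := by
  have key : ∀ (M : Matrix (m ⊕ n) (m ⊕ n) K) (B B' : Matrix m m K) (D D' : Matrix n n K),
      M * fromBlocks B 0 0 D = fromBlocks B' 0 0 D' * M →
      IsCoprime B'.charpoly D.charpoly → IsCoprime B.charpoly D'.charpoly →
      ∃ u v, M = fromBlocks u 0 0 v ∧ u * B = B' * u ∧ v * D = D' * v := by
    intro M B B' D D' hM h₁ h₂
    rw [← fromBlocks_toBlocks M, fromBlocks_multiply, fromBlocks_multiply, fromBlocks_inj] at hM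
    simp only [Matrix.mul_zero, Matrix.zero_mul, add_zero, zero_add] at hM
    refine ⟨M.toBlocks₁₁, M.toBlocks₂₂, ?_, hM.1, hM.2.2.2⟩
    conv_lhs => rw [← fromBlocks_toBlocks M]
    rw [eq_zero_of_mul_eq_mul_of_isCoprime_charpoly hM.2.1 h₁,
      eq_zero_of_mul_eq_mul_of_isCoprime_charpoly hM.2.2.1 h₂.symm]
  obtain ⟨u, v, huv, hu, hv⟩ := key _ _ _ _ _ hh h₁ h₂
  obtain ⟨u', v', huv', -, -⟩ := key (↑h⁻¹) B' B D' D (by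
    rw [Units.inv_mul_eq_iff_eq_mul, ← Matrix.mul_assoc, hh, Matrix.mul_assoc, h.mul_inv,
      Matrix.mul_one]) h₂ h₁
  have e₁ := h.mul_inv
  have e₂ := h.inv_mul
  rw [huv, huv', fromBlocks_multiply, ← fromBlocks_one, fromBlocks_inj] at e₁ e₂
  simp only [Matrix.mul_zero, Matrix.zero_mul, add_zero, zero_add] at e₁ e₂
  exact ⟨⟨u, u', e₁.1, e₂.1⟩, ⟨v, v', e₁.2.2.2, e₂.2.2.2⟩, Units.ext huv, hu, hv⟩

theorem Matrix.blockUnits_inj {R m n : Type*} [CommRing R] [Fintype m] [DecidableEq m] [Fintype n]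
    [DecidableEq n] {u u' : (Matrix m m R)ˣ} {v v' : (Matrix n n R)ˣ} :
    blockUnits u v = blockUnits u' v' ↔ u = u' ∧ v = v' := by
  rw [Units.ext_iff, Units.ext_iff, Units.ext_iff]
  simp [blockUnits, fromBlocks_inj]

theorem Matrix.card_sum_charpoly_eq_mul {F : Type*} [Field F] {a b : ℕ} (P Q : F[X] → Prop)
    (hPQ : ∀ p q, P p → Q q → IsCoprime p q) :
    Nat.card {A : Matrix (Fin a ⊕ Fin b) (Fin a ⊕ Fin b) F //
        ∃ p q, p.Monic ∧ p.natDegree = a ∧ q.natDegree = b ∧ P p ∧ Q q ∧ A.charpoly = p * q} *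
      (Nat.card (Matrix (Fin a) (Fin a) F)ˣ * Nat.card (Matrix (Fin b) (Fin b) F)ˣ) =
    Nat.card (Matrix (Fin a ⊕ Fin b) (Fin a ⊕ Fin b) F)ˣ *
      (Nat.card {B : Matrix (Fin a) (Fin a) F // P B.charpoly} *
        Nat.card {D : Matrix (Fin b) (Fin b) F // Q D.charpoly}) := by
  rw [← Nat.card_prod, ← Nat.card_prod, ← Nat.card_prod, ← Nat.card_prod]
  set S := {A : Matrix (Fin a ⊕ Fin b) (Fin a ⊕ Fin b) F //
        ∃ p q, p.Monic ∧ p.natDegree = a ∧ q.natDegree = b ∧ P p ∧ Q q ∧ A.charpoly = p * q}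
  have hS (A : S) : ∃ (g : (Matrix (Fin a ⊕ Fin b) (Fin a ⊕ Fin b) F)ˣ)
      (B : {B : Matrix (Fin a) (Fin a) F // P B.charpoly})
      (D : {D : Matrix (Fin b) (Fin b) F // Q D.charpoly}),
      A.1 = g.val * fromBlocks B.1 0 0 D.1 * g⁻¹.val := by
    obtain ⟨A, p, q, hp, hpa, hqb, hPp, hQq, hA⟩ := A
    obtain ⟨U, V, B, D, hUV, hVU, h, rfl, rfl⟩ :=
      exists_eq_conj_fromBlocks_of_charpoly_eq_mul A hp hpa hqb (hPQ p q hPp hQq) hA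
    exact ⟨⟨U, V, hUV, hVU⟩, ⟨B, hPp⟩, ⟨D, hQq⟩, h⟩
  choose g B D hgBD using hS
  have conj_mem {n : Type} [Fintype n] [DecidableEq n] {P : F[X] → Prop}
      (u : (Matrix n n F)ˣ) (B : {B : Matrix n n F // P B.charpoly}) :
      P (u⁻¹.val * B.1 * u.val).charpoly := by
    rw [coe_units_inv, charpoly_units_conj']; exact B.2
  let Φ : S × ((Matrix (Fin a) (Fin a) F)ˣ × (Matrix (Fin b) (Fin b) F)ˣ) →
      (Matrix (Fin a ⊕ Fin b) (Fin a ⊕ Fin b) F)ˣ ×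
      ({B : Matrix (Fin a) (Fin a) F // P B.charpoly} ×
        {D : Matrix (Fin b) (Fin b) F // Q D.charpoly}) := fun x =>
    (g x.1 * blockUnits x.2.1 x.2.2, ⟨x.2.1⁻¹.val * (B x.1).1 * x.2.1.val, conj_mem _ _⟩,
      ⟨x.2.2⁻¹.val * (D x.1).1 * x.2.2.val, conj_mem _ _⟩)
  have hΦ (x) : x.1.1 = (Φ x).1.val * fromBlocks (Φ x).2.1.1 0 0 (Φ x).2.2.1 * (Φ x).1⁻¹.val := by
    have : (blockUnits x.2.1 x.2.2).val * fromBlocks (Φ x).2.1.1 0 0 (Φ x).2.2.1 *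
        (blockUnits x.2.1 x.2.2)⁻¹.val = fromBlocks (B x.1).1 0 0 (D x.1).1 := by
      rw [Units.mul_inv_eq_iff_eq_mul]
      simp [blockUnits, fromBlocks_multiply, Φ, ← Matrix.mul_assoc, -coe_units_inv]
    rw [hgBD x.1, ← this]
    simp only [Φ, _root_.mul_inv_rev, Units.val_mul, Matrix.mul_assoc]
  refine Nat.card_congr (Equiv.ofBijective Φ ⟨fun x y hxy => ?_, fun y => ?_⟩)
  · have h1 : x.1 = y.1 := Subtype.ext (by rw [hΦ x, hΦ y, hxy])
    have h2 : blockUnits x.2.1 x.2.2 = blockUnits y.2.1 y.2.2 := by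
      have := congrArg Prod.fst hxy
      simpa only [Φ, h1, mul_right_inj] using this
    obtain ⟨h3, h4⟩ := blockUnits_inj.1 h2
    exact Prod.ext h1 (Prod.ext h3 h4)
  · obtain ⟨k, ⟨B', hB'⟩, ⟨D', hD'⟩⟩ := y
    let A : S := ⟨k.val * fromBlocks B' 0 0 D' * k⁻¹.val, B'.charpoly, D'.charpoly,
      B'.charpoly_monic, by simp, by simp, hB', hD', by
      rw [coe_units_inv, charpoly_units_conj, charpoly_fromBlocks_zero₁₂]⟩
    have hA : k.val * fromBlocks B' 0 0 D' * k⁻¹.val =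
      (g A).val * fromBlocks (B A).1 0 0 (D A).1 * (g A)⁻¹.val := hgBD A
    obtain ⟨u, v, huv, hu, hv⟩ := exists_eq_blockUnits_of_mul_eq ((g A)⁻¹ * k)
      (B := B') (D := D') (B' := (B A).1) (D' := (D A).1) (by
        rw [Units.mul_inv_eq_iff_eq_mul] at hA
        rw [Units.val_mul, Matrix.mul_assoc, hA]
        simp only [← Matrix.mul_assoc, Units.inv_mul, Matrix.one_mul])
      (hPQ _ _ (B A).2 hD') (hPQ _ _ hB' (D A).2)
    refine ⟨(A, u, v), Prod.ext ?_ (Prod.ext (Subtype.ext ?_) (Subtype.ext ?_))⟩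
    · simp only [Φ, ← huv, mul_inv_cancel_left]
    · simp only [Φ]
      rw [Matrix.mul_assoc, ← hu, ← Matrix.mul_assoc, Units.inv_mul, Matrix.one_mul]
    · simp only [Φ]
      rw [Matrix.mul_assoc, ← hv, ← Matrix.mul_assoc, Units.inv_mul, Matrix.one_mul]

theorem Matrix.card_charpoly_eq_mul {F : Type*} [Field F] {a b : ℕ} (P Q : F[X] → Prop)
    (hPQ : ∀ p q, P p → Q q → IsCoprime p q) :
    Nat.card {A : Matrix (Fin (a + b)) (Fin (a + b)) F //
        ∃ p q, p.Monic ∧ p.natDegree = a ∧ q.natDegree = b ∧ P p ∧ Q q ∧ A.charpoly = p * q} *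
      (Nat.card (Matrix (Fin a) (Fin a) F)ˣ * Nat.card (Matrix (Fin b) (Fin b) F)ˣ) =
    Nat.card (Matrix (Fin (a + b)) (Fin (a + b)) F)ˣ *
      (Nat.card {B : Matrix (Fin a) (Fin a) F // P B.charpoly} *
        Nat.card {D : Matrix (Fin b) (Fin b) F // Q D.charpoly}) := by
  rw [← Nat.card_congr (Units.mapEquiv
    (reindexAlgEquiv F F (finSumFinEquiv (m := a) (n := b))).toMulEquiv).toEquiv,
    ← card_sum_charpoly_eq_mul P Q hPQ]
  congr 1
  refine Nat.card_congr (Equiv.subtypeEquiv (reindex finSumFinEquiv finSumFinEquiv).symm fun A => ?_)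
  rw [reindex_symm, charpoly_reindex]

theorem Matrix.isUnit_iff_eval_zero_charpoly_ne_zero {K n : Type*} [Field K] [Fintype n]
    [DecidableEq n] (A : Matrix n n K) : IsUnit A ↔ A.charpoly.eval 0 ≠ 0 := by
  rw [← not_iff_not, not_not, ← spectrum.zero_mem_iff K, mem_spectrum_iff_isRoot_charpoly, IsRoot]

theorem Units.natCard_subtype_val {M : Type*} [Monoid M] (p : M → Prop)
    (hp : ∀ a, p a → IsUnit a) : Nat.card {u : Mˣ // p u.val} = Nat.card {a : M // p a} := by
  refine Nat.card_congr (Equiv.ofBijective (fun u => ⟨u.1.val, u.2⟩) ⟨fun u v h => ?_, ?_⟩)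
  · exact Subtype.ext (Units.ext (congrArg Subtype.val h))
  · rintro ⟨a, ha⟩
    obtain ⟨u, rfl⟩ := hp a ha
    exact ⟨⟨u, ha⟩, rfl⟩

theorem Matrix.natCard_units_eq_natCard_eval_zero_charpoly_ne_zero {K : Type*} [Field K] (n : ℕ) :
    Nat.card {A : Matrix (Fin n) (Fin n) K // A.charpoly.eval 0 ≠ 0} =
      Nat.card (Matrix (Fin n) (Fin n) K)ˣ := by
  rw [← Units.natCard_subtype_val _ fun A => (isUnit_iff_eval_zero_charpoly_ne_zero A).2]
  exact Nat.card_congr (Equiv.subtypeUnivEquiv fun u =>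
    (isUnit_iff_eval_zero_charpoly_ne_zero u.val).1 u.isUnit)

theorem Matrix.natCard_rootMultiplicity_zero_charpoly_mul {F : Type*} [Field F] [Fintype F]
    (k b : ℕ) :
    Nat.card {A : Matrix (Fin (k + b)) (Fin (k + b)) F // A.charpoly.rootMultiplicity 0 = k} *
      Nat.card (Matrix (Fin k) (Fin k) F)ˣ =
    Nat.card (Matrix (Fin (k + b)) (Fin (k + b)) F)ˣ *
      Nat.card {A : Matrix (Fin k) (Fin k) F // A.charpoly = X ^ k} := by
  have h := card_charpoly_eq_mul (F := F) (a := k) (b := b) (fun p => p = X ^ k)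
    (fun q => q.eval 0 ≠ 0) (by
      rintro _ q rfl hq
      refine IsCoprime.pow_left ((Polynomial.prime_X.irreducible.coprime_iff_not_dvd).2 ?_)
      rwa [X_dvd_iff, coeff_zero_eq_eval_zero])
  rw [natCard_units_eq_natCard_eval_zero_charpoly_ne_zero, ← mul_assoc, ← mul_assoc] at h
  have h' := Nat.eq_of_mul_eq_mul_right Nat.card_pos h
  rw [← h']
  congr 1
  refine Nat.card_congr (Equiv.subtypeEquivRight fun A => ⟨fun hA => ?_, ?_⟩)
  · obtain ⟨g, hg, hdvd⟩ := Polynomial.exists_eq_pow_rootMultiplicity_mul_and_not_dvd A.charpoly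
      A.charpoly_monic.ne_zero 0
    rw [hA, C_0, sub_zero] at hg
    rw [C_0, sub_zero] at hdvd
    refine ⟨X ^ k, g, monic_X_pow k, natDegree_X_pow k, ?_, rfl, ?_, hg⟩
    · have hd := congrArg natDegree hg
      have hg0 : g ≠ 0 := by rintro rfl; simp at hdvd
      rw [natDegree_mul (pow_ne_zero _ X_ne_zero) hg0, natDegree_X_pow] at hd
      simpa using hd.symm
    · rwa [X_dvd_iff, coeff_zero_eq_eval_zero] at hdvd
  · rintro ⟨_, q, -, -, -, rfl, hq, hA⟩
    have hq0 : q ≠ 0 := by rintro rfl; simp at hq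
    rw [hA, rootMultiplicity_mul (mul_ne_zero (pow_ne_zero _ X_ne_zero) hq0),
      rootMultiplicity_eq_zero (p := q) hq]
    simpa using rootMultiplicity_X_sub_C_pow (0 : F) k

theorem Matrix.natCard_units_succ {F : Type*} [Field F] [Fintype F] (n : ℕ) :
    (Nat.card (Matrix (Fin (n + 1)) (Fin (n + 1)) F)ˣ : ℝ) =
      ((Fintype.card F : ℝ) ^ (n + 1) - 1) * (Fintype.card F : ℝ) ^ n *
        Nat.card (Matrix (Fin n) (Fin n) F)ˣ := by
  have h (k : ℕ) : (Nat.card (Matrix (Fin k) (Fin k) F)ˣ : ℝ) =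
      ∏ i : Fin k, ((Fintype.card F : ℝ) ^ k - (Fintype.card F : ℝ) ^ (i : ℕ)) := by
    have := card_GL_field (𝔽 := F) k
    rw [GeneralLinearGroup] at this
    rw [this, Nat.cast_prod]
    refine Finset.prod_congr rfl fun i _ => ?_
    rw [Nat.cast_sub (Nat.pow_le_pow_right Fintype.card_pos i.2.le)]
    push_cast
    rfl
  have hprod : ∏ i : Fin n, ((Fintype.card F : ℝ) ^ (n + 1) -
        (Fintype.card F : ℝ) ^ (i.succ : ℕ)) =
      ∏ i : Fin n, (Fintype.card F : ℝ) *
        ((Fintype.card F : ℝ) ^ n - (Fintype.card F : ℝ) ^ (i : ℕ)) :=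
    Finset.prod_congr rfl fun i _ => by rw [Fin.val_succ]; ring
  rw [h, h, Fin.prod_univ_succ, hprod, Finset.prod_mul_distrib, Fin.prod_const, mul_assoc,
    Fin.val_zero, pow_zero]

theorem Matrix.natCard_charpoly_eq_X_pow {F : Type*} [Field F] [Fintype F] (n : ℕ) :
    (Nat.card {A : Matrix (Fin n) (Fin n) F // A.charpoly = X ^ n} : ℝ) =
      (Fintype.card F : ℝ) ^ (n ^ 2 - n) := by
  classical
  have hG (k : ℕ) : (Nat.card (Matrix (Fin k) (Fin k) F)ˣ : ℝ) ≠ 0 :=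
    Nat.cast_ne_zero.2 Nat.card_pos.ne'
  have hsum (n : ℕ) : ∑ k ∈ Finset.range (n + 1),
      (Nat.card {A : Matrix (Fin k) (Fin k) F // A.charpoly = X ^ k} : ℝ) /
        Nat.card (Matrix (Fin k) (Fin k) F)ˣ =
      (Fintype.card F : ℝ) ^ (n ^ 2) / Nat.card (Matrix (Fin n) (Fin n) F)ˣ := by
    have hfib := Finset.card_eq_sum_card_fiberwise
      (s := (Finset.univ : Finset (Matrix (Fin n) (Fin n) F))) (t := Finset.range (n + 1))
      (f := fun A => A.charpoly.rootMultiplicity 0) (fun A _ => by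
        have := (roots A.charpoly).count_le_card 0
        have h2 := A.charpoly.card_roots'
        rw [count_roots] at this
        rw [charpoly_natDegree_eq_dim, Fintype.card_fin] at h2
        simp only [Finset.coe_range, Set.mem_Iio]
        lia)
    have hcard : (Finset.univ : Finset (Matrix (Fin n) (Fin n) F)).card
        = Fintype.card F ^ (n ^ 2) := by
      rw [Finset.card_univ, ← Fintype.card_congr Matrix.of, Fintype.card_fun,
        Fintype.card_fun, Fintype.card_fin, ← pow_mul, sq]
    rw [hcard] at hfib
    rw [eq_div_iff (hG n), Finset.sum_mul, ← Nat.cast_pow, hfib, Nat.cast_sum]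
    refine Finset.sum_congr rfl fun k hk => ?_
    obtain ⟨b, rfl⟩ := Nat.exists_eq_add_of_le (Nat.lt_succ_iff.1 (Finset.mem_range.1 hk))
    rw [← Fintype.card_subtype, ← Nat.card_eq_fintype_card, div_mul_eq_mul_div, div_eq_iff (hG k),
      mul_comm]
    exact_mod_cast (natCard_rootMultiplicity_zero_charpoly_mul (F := F) k b).symm
  cases n with
  | zero => simpa [hG 0] using hsum 0
  | succ n =>
    have h := hsum (n + 1)
    rw [Finset.sum_range_succ, hsum n, ← eq_sub_iff_add_eq', div_sub_div _ _ (hG _) (hG _),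
      div_eq_div_iff (hG _) (mul_ne_zero (hG _) (hG _))] at h
    have hG' := hG n
    have hG'' := hG (n + 1)
    have he : (n + 1) ^ 2 - (n + 1) = n ^ 2 + n := by
      rw [Nat.sub_eq_iff_eq_add (by nlinarith)]; ring
    rw [he]
    refine mul_right_cancel₀ (mul_ne_zero hG'' hG') ?_
    rw [h, natCard_units_succ]
    ring

theorem Matrix.natCard_charpoly_eq_X_sub_C_pow {F : Type*} [Field F] [Fintype F] (n : ℕ) (c : F) :
    (Nat.card {A : Matrix (Fin n) (Fin n) F // A.charpoly = (X - C c) ^ n} : ℝ) =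
      (Fintype.card F : ℝ) ^ (n ^ 2 - n) := by
  rw [← natCard_charpoly_eq_X_pow (F := F) n]
  congr 1
  refine Nat.card_congr (Equiv.subtypeEquiv (Equiv.subRight (scalar (Fin n) c)) fun A => ?_)
  rw [Equiv.subRight_apply, charpoly_sub_scalar, ← taylor_apply,
    ← (taylor_injective c).eq_iff (a := A.charpoly)]
  simp [taylor_apply]

theorem natCard_charpoly_eq_mul_prod {F : Type*} [Field F] [Fintype F] (m : F → ℕ) (r : ℕ)
    (s : Finset F) (n : ℕ) (hn : n = r + ∑ c ∈ s, m c) :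
    (Nat.card {A : Matrix (Fin n) (Fin n) F //
        ∃ f : F[X], f.Monic ∧ f.natDegree = r ∧ (∀ t : F, f.eval t ≠ 0) ∧
          A.charpoly = f * ∏ c ∈ s, (X - C c) ^ m c} : ℝ) =
      (Nat.card (Matrix (Fin n) (Fin n) F)ˣ : ℝ) * vGL F r *
        ∏ c ∈ s, (Fintype.card F : ℝ) ^ (m c ^ 2 - m c) /
          (Nat.card (Matrix (Fin (m c)) (Fin (m c)) F)ˣ : ℝ) := by
  classical
  have hG (k : ℕ) : (Nat.card (Matrix (Fin k) (Fin k) F)ˣ : ℝ) ≠ 0 :=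
    Nat.cast_ne_zero.2 Nat.card_pos.ne'
  induction s using Finset.induction_on generalizing n with
  | empty =>
    obtain rfl : n = r := by simpa using hn
    rw [vGL, mul_div_cancel₀ _ (hG n), Units.natCard_subtype_val
      (fun A : Matrix (Fin n) (Fin n) F => ∀ t : F, A.charpoly.eval t ≠ 0)
      fun A h => (Matrix.isUnit_iff_eval_zero_charpoly_ne_zero A).2 (h 0)]
    simp only [Finset.prod_empty, mul_one]
    congr 1
    refine Nat.card_congr (Equiv.subtypeEquivRight fun A => ⟨?_, fun h => ?_⟩)
    · rintro ⟨f, -, -, hf, hA⟩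
      simpa [hA] using hf
    · exact ⟨A.charpoly, A.charpoly_monic, by simp, h, by simp⟩
  | insert c s hc ih =>
    have hn' : n = r + ∑ c ∈ s, m c + m c := by rw [hn, Finset.sum_insert hc]; ring
    clear hn
    subst hn'
    have hmon (f : F[X]) (hf : f.Monic) : (f * ∏ c ∈ s, (X - C c) ^ m c).Monic :=
      hf.mul (monic_prod_of_monic _ _ fun c _ => (monic_X_sub_C c).pow _)
    have hcop (p q : F[X]) (hp : ∃ f : F[X], f.Monic ∧ f.natDegree = r ∧ (∀ t : F, f.eval t ≠ 0) ∧
        p = f * ∏ c ∈ s, (X - C c) ^ m c) (hq : q = (X - C c) ^ m c) : IsCoprime p q := by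
      obtain ⟨f, -, -, hf, rfl⟩ := hp
      subst hq
      refine IsCoprime.pow_right (IsCoprime.mul_left ?_ (IsCoprime.prod_left fun d hd =>
        IsCoprime.pow_left ?_))
      · refine ((irreducible_X_sub_C c).coprime_iff_not_dvd.2 ?_).symm
        rw [dvd_iff_isRoot]
        exact hf c
      · refine isCoprime_X_sub_C_of_isUnit_sub (IsUnit.mk0 _ (sub_ne_zero.2 ?_))
        rintro rfl
        exact hc hd
    have h := Matrix.card_charpoly_eq_mul (a := r + ∑ c ∈ s, m c) (b := m c) _ _ hcop
    have h' := congrArg (Nat.cast (R := ℝ)) h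
    simp only [Nat.cast_mul] at h'
    rw [ih _ rfl, Matrix.natCard_charpoly_eq_X_sub_C_pow, ← eq_div_iff (mul_ne_zero (hG _) (hG _))]
      at h'
    simp only [Finset.prod_insert hc]
    refine Eq.trans ?_ (h'.trans ?_)
    · refine congrArg Nat.cast (Nat.card_congr (Equiv.subtypeEquivRight fun A => ⟨?_, ?_⟩))
      · rintro ⟨f, hf, hfr, hf0, hA⟩
        refine ⟨_, _, hmon f hf, ?_, ?_, ⟨f, hf, hfr, hf0, rfl⟩, rfl, ?_⟩
        · rw [hf.natDegree_mul (monic_prod_of_monic _ _ fun c _ => (monic_X_sub_C c).pow _),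
            natDegree_prod_of_monic _ _ fun c _ => (monic_X_sub_C c).pow _, hfr]
          simp
        · simp
        · rw [hA]
          ring
      · rintro ⟨p, q, -, -, -, ⟨f, hf, hfr, hf0, rfl⟩, rfl, hA⟩
        refine ⟨f, hf, hfr, hf0, ?_⟩
        rw [hA]
        ring
    · have := hG (m c)
      have := hG (r + ∑ c ∈ s, m c)
      field_simp

/-- The count of matrices in `M(n, F_q)` with prescribed eigenvalue multiplicity profile `m`:
`|C_m(n,q)| = |GL(n,q)| · v(GL, r, q) · ∏_λ q^{m(λ)² − m(λ)} / |GL(m(λ), q)|`,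
where `r = n − Σ_λ m(λ)`. -/
theorem stmt_6 (F : Type*) [Field F] [Fintype F] (q n : ℕ) (hq : Fintype.card F = q)
    (m : F → ℕ) (hD : ∑ lam : F, m lam ≤ n) :
    (Nat.card {A : Matrix (Fin n) (Fin n) F //
        ∃ f₀ : Polynomial F, f₀.Monic ∧ f₀.natDegree = n - ∑ lam : F, m lam ∧
          (∀ t : F, f₀.eval t ≠ 0) ∧
          A.charpoly = f₀ * ∏ lam : F, (X - C lam) ^ m lam} : ℝ)
      = (Nat.card (Matrix (Fin n) (Fin n) F)ˣ : ℝ) * vGL F (n - ∑ lam : F, m lam)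
        * ∏ lam : F,
            (q : ℝ) ^ (m lam ^ 2 - m lam)
              / (Nat.card (Matrix (Fin (m lam)) (Fin (m lam)) F)ˣ : ℝ) := by
  subst hq
  exact natCard_charpoly_eq_mul_prod m _ Finset.univ n (Nat.sub_add_cancel hD).symm
end

section
/- Let q be a prime power and n ≥ 1. Let C₁(n, q) be the set of matrices A ∈ M(n, F_q) that have exactly one eigenvalue in F_q, and this eigenvalue has algebraic multiplicity 1; equivalently, c_A(t) = f₀(t)·(t − λ) for some λ ∈ F_q, where f₀ is monic of degree n−1 with no roots in F_q. Then α(n, q) := |C₁(n, q)| / q^{n²} satisfies α(n, q) = (q/(q−1)) · v(GL, n−1, q) · c_n(q). -/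
open Matrix Polynomial

/-- If the intertwiners between images of elements of `E` under an injective monoid homomorphism
`D` come from units of the source, then the conjugates of `D x`, `x ∈ E`, are counted by an
orbit-stabilizer formula. -/
theorem card_conj_mul_card_units {R S : Type*} [Monoid R] [Monoid S] (D : R →* S)
    (hD : Function.Injective D) (E : Set R)
    (hE : ∀ x ∈ E, ∀ h : Rˣ, (h : R) * x * (h⁻¹ : Rˣ) ∈ E)
    (hint : ∀ x ∈ E, ∀ y ∈ E, ∀ P : Sˣ, (P : S) * D x = D y * P → ∃ h : Rˣ, Units.map D h = P) :
    Nat.card {A : S // ∃ P : Sˣ, ∃ x ∈ E, A = P * D x * (P⁻¹ : Sˣ)} * Nat.card Rˣ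
      = Nat.card Sˣ * Nat.card E := by
  rw [← Nat.card_prod, ← Nat.card_prod]
  have hmem (A : {A : S // ∃ P : Sˣ, ∃ x ∈ E, A = P * D x * (P⁻¹ : Sˣ)}) := A.2
  choose P x hx hA using hmem
  have hconj (Q : Sˣ) (y : R) (h : Rˣ) :
      ((Q * (Units.map D h)⁻¹ : Sˣ) : S) * D (h * y * (h⁻¹ : Rˣ))
        * ((Q * (Units.map D h)⁻¹)⁻¹ : Sˣ) = Q * D y * (Q⁻¹ : Sˣ) := by
    have h1 : ((Units.map D h)⁻¹ : Sˣ) * D h = 1 := (Units.map D h).inv_mul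
    have h2 : D (h⁻¹ : Rˣ) * (Units.map D h : Sˣ) = 1 := by simp [← map_mul]
    rw [_root_.mul_inv_rev, inv_inv, Units.val_mul, Units.val_mul, map_mul, map_mul]
    calc _ = (Q : S) * (((Units.map D h)⁻¹ : Sˣ) * D h) * D y
            * (D (h⁻¹ : Rˣ) * (Units.map D h : Sˣ)) * (Q⁻¹ : Sˣ) := by simp only [mul_assoc]
      _ = _ := by rw [h1, h2, mul_one, mul_one]
  refine Nat.card_congr (Equiv.ofBijective
    (fun z => (P z.1 * (Units.map D z.2)⁻¹, ⟨_, hE _ (hx z.1) z.2⟩)) ⟨?_, ?_⟩)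
  · rintro ⟨A, g⟩ ⟨B, h⟩ hAB
    simp only [Prod.mk.injEq, Subtype.mk.injEq] at hAB
    have hAB' : A = B := by
      apply Subtype.ext
      rw [hA A, hA B, ← hconj (P A) (x A) g, ← hconj (P B) (x B) h, hAB.1, hAB.2]
    subst hAB'
    have := inv_injective (mul_left_cancel hAB.1)
    rw [Units.map_injective hD this]
  · rintro ⟨Q, y, hy⟩
    let A : {A : S // ∃ P : Sˣ, ∃ x ∈ E, A = P * D x * (P⁻¹ : Sˣ)} :=
      ⟨Q * D y * (Q⁻¹ : Sˣ), Q, y, hy, rfl⟩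
    have hAe : (Q : S) * D y * (Q⁻¹ : Sˣ) = P A * D (x A) * ((P A)⁻¹ : Sˣ) := hA A
    obtain ⟨h, hh⟩ := hint (x A) (hx A) y hy (Q⁻¹ * P A) (by
      calc ((Q⁻¹ * P A : Sˣ) : S) * D (x A)
          = (Q⁻¹ : Sˣ) * (P A * D (x A) * ((P A)⁻¹ : Sˣ)) * P A := by simp [mul_assoc]
        _ = _ := by rw [← hAe]; simp [mul_assoc])
    refine ⟨(A, h), ?_⟩
    simp only [Prod.mk.injEq, Subtype.mk.injEq]
    refine ⟨by simp [hh], ?_⟩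
    apply hD
    have h2 : D (h⁻¹ : Rˣ) = ((Units.map D h)⁻¹ : Sˣ) := rfl
    have h3 : D h = (Units.map D h : Sˣ) := rfl
    rw [map_mul, map_mul, h2, h3, hh]
    calc _ = (Q⁻¹ : Sˣ) * (P A * D (x A) * ((P A)⁻¹ : Sˣ)) * Q := by simp [mul_assoc]
      _ = _ := by rw [← hAe]; simp [mul_assoc]

section

variable {F ι : Type*} [Field F] [Fintype ι] [DecidableEq ι]

/-- The block diagonal embedding `(B, a) ↦ diag(B, a)`. -/
def blockDiagScalar (F ι : Type*) [Field F] [Fintype ι] [DecidableEq ι] :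
    Matrix ι ι F × F →* Matrix (ι ⊕ Unit) (ι ⊕ Unit) F where
  toFun x := fromBlocks x.1 0 0 (x.2 • 1)
  map_one' := by simp
  map_mul' x y := by simp [fromBlocks_multiply, smul_smul, mul_comm]

theorem blockDiagScalar_apply (x : Matrix ι ι F × F) :
    blockDiagScalar F ι x = fromBlocks x.1 0 0 (x.2 • 1) := rfl

theorem blockDiagScalar_injective : Function.Injective (blockDiagScalar F ι) := by
  rintro ⟨B, a⟩ ⟨B', a'⟩ h
  obtain ⟨h1, -, -, h2⟩ := fromBlocks_inj.1 h
  have := congrFun (congrFun h2 ()) ()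
  simp_all

theorem isUnit_scalar_sub_det {B : Matrix ι ι F} {t : F} (h : B.charpoly.eval t ≠ 0) :
    IsUnit (scalar ι t - B).det := by
  rw [← eval_charpoly]
  exact h.isUnit

theorem eq_zero_of_mul_eq_smul {κ : Type*} {B : Matrix ι ι F} {t : F}
    (h : B.charpoly.eval t ≠ 0) {X : Matrix ι κ F} (hX : B * X = t • X) : X = 0 := by
  have h0 : (scalar ι t - B) * X = 0 := by
    rw [Matrix.sub_mul, hX]
    simp [← smul_one_eq_diagonal]
  rw [← nonsing_inv_mul_cancel_left (scalar ι t - B) X (isUnit_scalar_sub_det h), h0,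
    Matrix.mul_zero]

theorem eq_zero_of_mul_eq_smul' {κ : Type*} {B : Matrix ι ι F} {t : F}
    (h : B.charpoly.eval t ≠ 0) {X : Matrix κ ι F} (hX : X * B = t • X) : X = 0 := by
  have h0 : X * (scalar ι t - B) = 0 := by
    rw [Matrix.mul_sub, hX]
    simp [← smul_one_eq_diagonal]
  rw [← mul_nonsing_inv_cancel_right (scalar ι t - B) X (isUnit_scalar_sub_det h), h0,
    Matrix.zero_mul]

theorem exists_units_map_blockDiagScalar_eq {x y : Matrix ι ι F × F}
    (hx : ∀ t, x.1.charpoly.eval t ≠ 0) (hy : ∀ t, y.1.charpoly.eval t ≠ 0)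
    (P : (Matrix (ι ⊕ Unit) (ι ⊕ Unit) F)ˣ)
    (hP : P.val * blockDiagScalar F ι x = blockDiagScalar F ι y * P.val) :
    ∃ h, Units.map (blockDiagScalar F ι) h = P := by
  obtain ⟨a, b, c, d, habcd⟩ : ∃ a b c d, P.val = fromBlocks a b c d :=
    ⟨_, _, _, _, (fromBlocks_toBlocks P.val).symm⟩
  rw [habcd, blockDiagScalar_apply, blockDiagScalar_apply, fromBlocks_multiply,
    fromBlocks_multiply] at hP
  obtain ⟨-, h12, h21, -⟩ := fromBlocks_inj.1 hP
  have hb : b = 0 := eq_zero_of_mul_eq_smul (hy x.2) (by simpa using h12.symm)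
  have hc : c = 0 := eq_zero_of_mul_eq_smul' (hx y.2) (by simpa using h21)
  subst hb hc
  have hdet : IsUnit (a.det * d.det) := by
    rw [← det_fromBlocks_zero₁₂ a 0 d, ← habcd]
    exact (isUnit_iff_isUnit_det _).1 P.isUnit
  have ha : IsUnit a := (isUnit_iff_isUnit_det a).2 (isUnit_of_mul_isUnit_left hdet)
  have hd : IsUnit (d () ()) := by simpa using isUnit_of_mul_isUnit_right hdet
  obtain ⟨a, rfl⟩ := ha
  obtain ⟨e, he⟩ := hd
  refine ⟨MulEquiv.prodUnits.symm (a, e), Units.ext ?_⟩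
  rw [habcd, Units.coe_map]
  change fromBlocks a.val 0 0 (e.val • 1) = _
  congr 1
  ext ⟨⟩ ⟨⟩
  simp [he]

/-- The general linear group is transitive on nonzero vectors. -/
theorem exists_unit_mulVec_single_eq {κ : Type*} [Fintype κ] [DecidableEq κ] (j : κ)
    {v : κ → F} (hv : v ≠ 0) : ∃ P : (Matrix κ κ F)ˣ, P.val *ᵥ Pi.single j 1 = v := by
  obtain ⟨i, hi⟩ := Function.ne_iff.1 hv
  have hu : IsUnit (((1 : Matrix κ κ F).updateCol i v).submatrix id (Equiv.swap i j)) := by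
    rw [isUnit_iff_isUnit_det, det_permute', ← cramer_apply, cramer_one]
    refine IsUnit.mul ?_ (by simpa using hi)
    rcases Int.units_eq_one_or (Equiv.Perm.sign (Equiv.swap i j)) with h | h <;> simp [h]
  refine ⟨hu.unit, ?_⟩
  ext k
  simp

theorem exists_conj_blockDiagScalar {A : Matrix (ι ⊕ Unit) (ι ⊕ Unit) F} {lam : F} {f : F[X]}
    (hf : ∀ t, f.eval t ≠ 0) (hA : A.charpoly = f * (X - C lam)) :
    ∃ P : (Matrix (ι ⊕ Unit) (ι ⊕ Unit) F)ˣ, ∃ x ∈ {x : Matrix ι ι F × F |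
      ∀ t, x.1.charpoly.eval t ≠ 0},
      A = P.val * blockDiagScalar F ι x * (P⁻¹).val := by
  have hdet : (scalar _ lam - A).det = 0 := by rw [← eval_charpoly, hA]; simp
  obtain ⟨v, hv, hAv⟩ := exists_mulVec_eq_zero_iff.2 hdet
  have hAv' : A *ᵥ v = lam • v := by
    rw [sub_mulVec, sub_eq_zero] at hAv
    simp [← hAv, ← smul_one_eq_diagonal, smul_mulVec]
  obtain ⟨P, hP⟩ := exists_unit_mulVec_single_eq (Sum.inr () : ι ⊕ Unit) hv
  have hcol : ((P⁻¹).val * A * P.val) *ᵥ Pi.single (Sum.inr ()) 1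
      = lam • Pi.single (Sum.inr ()) 1 := by
    rw [← mulVec_mulVec, hP, ← mulVec_mulVec, hAv', mulVec_smul, ← hP, mulVec_mulVec,
      P.inv_mul, one_mulVec]
  obtain ⟨B, b, c, d, hM⟩ : ∃ B b c d, (P⁻¹).val * A * P.val = fromBlocks B b c d :=
    ⟨_, _, _, _, (fromBlocks_toBlocks _).symm⟩
  rw [hM] at hcol
  have hb : b = 0 := by
    ext i ⟨⟩
    simpa using congrFun hcol (Sum.inl i)
  have hd : d = lam • 1 := by
    ext ⟨⟩ ⟨⟩
    simpa using congrFun hcol (Sum.inr ())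
  subst hb hd
  have hchar : B.charpoly = f := by
    have h1 : A.charpoly = B.charpoly * (X - C lam) := by
      have h2 : ((P⁻¹).val * A * P.val).charpoly = A.charpoly := by
        rw [Matrix.charpoly_mul_comm, ← mul_assoc, P.mul_inv, one_mul]
      rw [← h2, hM, charpoly_fromBlocks_zero₁₂]
      simp [charpoly, charmatrix]
    exact mul_right_cancel₀ (X_sub_C_ne_zero lam) (h1.symm.trans hA)
  subst hchar
  -- Conjugating by a unipotent lower triangular matrix clears the remaining block.
  obtain ⟨y, hy⟩ : ∃ y : Matrix Unit ι F, lam • y - y * B = c :=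
    ⟨c * (scalar ι lam - B)⁻¹, by
      have := nonsing_inv_mul_cancel_right (scalar ι lam - B) c (isUnit_scalar_sub_det (hf lam))
      rw [Matrix.mul_sub] at this
      simpa [← smul_one_eq_diagonal] using this⟩
  let U : (Matrix (ι ⊕ Unit) (ι ⊕ Unit) F)ˣ :=
    ⟨fromBlocks 1 0 y 1, fromBlocks 1 0 (-y) 1, by simp [fromBlocks_multiply],
      by simp [fromBlocks_multiply]⟩
  have hU : (P⁻¹).val * A * P.val * U⁻¹.val = U⁻¹.val * blockDiagScalar F ι (B, lam) := by
    rw [hM, blockDiagScalar_apply]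
    change fromBlocks _ _ _ _ * fromBlocks 1 0 (-y) 1 = fromBlocks 1 0 (-y) 1 * _
    simp [fromBlocks_multiply, ← hy, sub_add_eq_add_sub]
  refine ⟨P * U⁻¹, (B, lam), hf, ?_⟩
  rw [Units.eq_mul_inv_iff_mul_eq, Units.val_mul, mul_assoc P.val, ← hU]
  simp only [mul_assoc, Units.mul_inv_cancel_left]

theorem charpoly_conj_blockDiagScalar (P : (Matrix (ι ⊕ Unit) (ι ⊕ Unit) F)ˣ)
    (x : Matrix ι ι F × F) :
    (P.val * blockDiagScalar F ι x * (P⁻¹).val).charpoly = x.1.charpoly * (X - C x.2) := by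
  rw [Matrix.charpoly_mul_comm, ← mul_assoc, P.inv_mul, one_mul, blockDiagScalar_apply,
    charpoly_fromBlocks_zero₁₂]
  simp [charpoly, charmatrix]

theorem card_simple_eigenvalue_mul [Finite F] :
    Nat.card {A : Matrix (ι ⊕ Unit) (ι ⊕ Unit) F //
        ∃ (lam : F) (f : F[X]), f.Monic ∧ f.natDegree = Fintype.card ι ∧
          (∀ t : F, f.eval t ≠ 0) ∧ A.charpoly = f * (X - C lam)}
        * (Nat.card (Matrix ι ι F)ˣ * Nat.card Fˣ)
      = Nat.card (Matrix (ι ⊕ Unit) (ι ⊕ Unit) F)ˣ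
        * (Nat.card {B : Matrix ι ι F // ∀ t : F, B.charpoly.eval t ≠ 0} * Nat.card F) := by
  have key := card_conj_mul_card_units (blockDiagScalar F ι) blockDiagScalar_injective
    {x | ∀ t, x.1.charpoly.eval t ≠ 0}
    (fun x hx h t => by
      have : ((h : Matrix ι ι F × F) * x * (h⁻¹ : (Matrix ι ι F × F)ˣ)).1.charpoly
          = x.1.charpoly := by
        rw [Prod.fst_mul, Prod.fst_mul, Matrix.charpoly_mul_comm, ← mul_assoc, ← Prod.fst_mul,
          h.inv_mul, Prod.fst_one, one_mul]
      rw [this]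
      exact hx t)
    (fun x hx y hy P hP => exists_units_map_blockDiagScalar_eq hx hy P hP)
  rw [Nat.card_congr MulEquiv.prodUnits.toEquiv, Nat.card_prod] at key
  have hE : Nat.card {x : Matrix ι ι F × F | ∀ t, x.1.charpoly.eval t ≠ 0}
      = Nat.card {B : Matrix ι ι F // ∀ t : F, B.charpoly.eval t ≠ 0} * Nat.card F := by
    rw [← Nat.card_prod]
    exact Nat.card_congr
      ⟨fun x => (⟨x.1.1, x.2⟩, x.1.2), fun x => ⟨(x.1.1, x.2), x.1.2⟩, fun _ => rfl, fun _ => rfl⟩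
  rw [hE] at key
  rw [← key]
  congr 1
  refine Nat.card_congr (Equiv.subtypeEquivRight fun A => ⟨?_, ?_⟩)
  · rintro ⟨lam, f, -, -, hf, hA⟩
    exact exists_conj_blockDiagScalar hf hA
  · rintro ⟨P, x, hx, rfl⟩
    exact ⟨x.2, x.1.charpoly, charpoly_monic _, charpoly_natDegree_eq_dim _, hx,
      charpoly_conj_blockDiagScalar P x⟩

theorem card_units_charpoly_no_roots :
    Nat.card {A : (Matrix ι ι F)ˣ // ∀ t : F, A.val.charpoly.eval t ≠ 0}
      = Nat.card {B : Matrix ι ι F // ∀ t : F, B.charpoly.eval t ≠ 0} := by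
  refine Nat.card_congr (Equiv.ofBijective (fun A => ⟨A.1.val, A.2⟩) ⟨?_, ?_⟩)
  · intro A B h
    exact Subtype.ext (Units.ext (congrArg Subtype.val h))
  · rintro ⟨B, hB⟩
    have hu : IsUnit B := by
      have := isUnit_scalar_sub_det (hB 0)
      rwa [map_zero, zero_sub, ← isUnit_iff_isUnit_det, IsUnit.neg_iff] at this
    exact ⟨⟨hu.unit, hB⟩, rfl⟩

end

theorem card_units_matrix (F : Type*) [Field F] [Fintype F] (n : ℕ) :
    (Nat.card (Matrix (Fin n) (Fin n) F)ˣ : ℝ)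
      = (Fintype.card F : ℝ) ^ (n ^ 2)
        * ∏ i ∈ Finset.Icc 1 n, (1 - ((Fintype.card F : ℝ))⁻¹ ^ i) := by
  have hq : (Fintype.card F : ℝ) ≠ 0 := by exact_mod_cast Fintype.card_ne_zero
  have hq1 : 1 ≤ Fintype.card F := Fintype.card_pos
  rw [show Nat.card (Matrix (Fin n) (Fin n) F)ˣ = _ from card_GL_field n, Nat.cast_prod,
    Finset.prod_congr rfl (g := fun i : Fin n => (Fintype.card F : ℝ) ^ n
      * (1 - ((Fintype.card F : ℝ))⁻¹ ^ (n - (i : ℕ))))]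
  · rw [Finset.prod_mul_distrib, Finset.prod_const, Finset.card_univ, Fintype.card_fin, ← pow_mul,
      ← sq, Fin.prod_univ_eq_prod_range
        (fun i => 1 - ((Fintype.card F : ℝ))⁻¹ ^ (n - i)) n,
      ← Finset.prod_range_reflect, Finset.range_eq_Ico, Finset.prod_Ico_eq_prod_range,
      ← Finset.Ico_add_one_right_eq_Icc, Finset.prod_Ico_eq_prod_range]
    congr 1
    refine Finset.prod_congr (by simp) fun i hi => ?_
    rw [Finset.mem_range] at hi
    congr 2
    omega
  · intro i _
    rw [Nat.cast_sub (Nat.pow_le_pow_right hq1 i.2.le), mul_sub, mul_one, inv_pow,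
      pow_sub₀ _ hq i.2.le]
    push_cast
    field_simp

/-- For `n ≥ 1`, the proportion `α(n, q)` of matrices in `M(n, F_q)` having exactly one
eigenvalue in `F_q`, of algebraic multiplicity `1`, equals
`(q/(q−1)) · v(GL, n−1, q) · c_n(q)` where `c_n(q) = ∏_{i=1}^n (1 − q^{−i})`. -/
theorem stmt_8 (F : Type*) [Field F] [Fintype F] (q n : ℕ) (hq : Fintype.card F = q)
    (hn : 1 ≤ n) :
    (Nat.card {A : Matrix (Fin n) (Fin n) F //
        ∃ (lam : F) (f₀ : Polynomial F), f₀.Monic ∧ f₀.natDegree = n - 1 ∧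
          (∀ t : F, f₀.eval t ≠ 0) ∧ A.charpoly = f₀ * (X - C lam)} : ℝ)
        / (q : ℝ) ^ (n ^ 2)
      = ((q : ℝ) / ((q : ℝ) - 1)) * vGL F (n - 1)
          * ∏ i ∈ Finset.Icc 1 n, (1 - ((q : ℝ))⁻¹ ^ i) := by

  obtain ⟨m, rfl⟩ : ∃ m, n = m + 1 := ⟨n - 1, by omega⟩
  subst hq
  let e : Fin m ⊕ Unit ≃ Fin (m + 1) :=
    (Equiv.sumCongr (Equiv.refl _) (Equiv.ofUnique Unit (Fin 1))).trans finSumFinEquiv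
  have key := card_simple_eigenvalue_mul (F := F) (ι := Fin m)
  have hcard : Nat.card {A : Matrix (Fin m ⊕ Unit) (Fin m ⊕ Unit) F //
        ∃ (lam : F) (f : F[X]), f.Monic ∧ f.natDegree = Fintype.card (Fin m) ∧
          (∀ t : F, f.eval t ≠ 0) ∧ A.charpoly = f * (X - C lam)}
      = Nat.card {A : Matrix (Fin (m + 1)) (Fin (m + 1)) F //
        ∃ (lam : F) (f₀ : F[X]), f₀.Monic ∧ f₀.natDegree = m + 1 - 1 ∧
          (∀ t : F, f₀.eval t ≠ 0) ∧ A.charpoly = f₀ * (X - C lam)} :=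
    Nat.card_congr ((reindex e e).subtypeEquiv fun A => by
      rw [charpoly_reindex, Fintype.card_fin, Nat.add_sub_cancel])
  rw [hcard, Nat.card_congr (Units.mapEquiv (reindexRingEquiv F e).toMulEquiv).toEquiv,
    Nat.card_units F, Nat.card_eq_fintype_card (α := F), ← card_units_charpoly_no_roots] at key
  have hq1 : 1 < Fintype.card F := Fintype.one_lt_card
  have keyR := congrArg (Nat.cast : ℕ → ℝ) key
  rw [Nat.cast_mul, Nat.cast_mul, Nat.cast_mul, Nat.cast_mul, card_units_matrix F (m + 1),
    Nat.cast_sub hq1.le, Nat.cast_one] at keyR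
  have hq0 : (Fintype.card F : ℝ) ≠ 0 := by exact_mod_cast Fintype.card_ne_zero
  have hqs : (Fintype.card F : ℝ) - 1 ≠ 0 := sub_ne_zero.2 (by exact_mod_cast hq1.ne')
  have hG : (Nat.card (Matrix (Fin m) (Fin m) F)ˣ : ℝ) ≠ 0 := by exact_mod_cast Nat.card_pos.ne'
  rw [vGL, Nat.add_sub_cancel, div_mul_div_comm, div_mul_eq_mul_div,
    div_eq_div_iff (pow_ne_zero _ hq0) (mul_ne_zero hqs hG)]
  rw [Nat.add_sub_cancel] at keyR
  linear_combination keyR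
end

section
/- Let q be a prime power and define α(n, q) := |C₁(n, q)| / q^{n²}, where C₁(n, q) is the set of A ∈ M(n, F_q) whose characteristic polynomial factors as f₀(t)·(t − λ) for some λ ∈ F_q, with f₀ monic of degree n−1 having no roots in F_q. Then α(∞, q) := lim_{n→∞} α(n, q) exists and equals q·c(q)^q/(q−1) ≥ e^{−23/9}. Moreover, for every n > 5(q−1)², |α(∞, q) − α(n+1, q)| ≤ (q/(q−1)) · ((1/2)·16^{q−1}·q^{−(n+1)(n+q)/(2(q−1))} + 4·q^{−(n+1)}). -/
open Matrix Polynomial Filter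

/-- `α(n, q) := |C₁(n, q)| / q^{n²}`, where `C₁(n, q)` is the set of matrices in `M(n, F_q)`
whose characteristic polynomial factors as `f₀(t)·(t − λ)` with `λ ∈ F_q` and `f₀` monic of
degree `n − 1` with no roots in `F_q`. -/
noncomputable def alphaC1 (F : Type*) [Field F] [Fintype F] (q n : ℕ) : ℝ :=
  (Nat.card {A : Matrix (Fin n) (Fin n) F //
      ∃ (lam : F) (f₀ : Polynomial F), f₀.Monic ∧ f₀.natDegree = n - 1 ∧
        (∀ t : F, f₀.eval t ≠ 0) ∧ A.charpoly = f₀ * (X - C lam)} : ℝ)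
    / (q : ℝ) ^ (n ^ 2)

section BlockDecomposition

variable {F : Type*} [Field F] {k m : ℕ}

theorem pow_sub_scalar_eq_zero {N : Matrix (Fin k) (Fin k) F} {lam : F}
    (hN : N.charpoly = (X - C lam) ^ k) : (N - scalar (Fin k) lam) ^ k = 0 := by
  have h := Matrix.aeval_self_charpoly N
  rw [hN] at h
  simpa [Algebra.algebraMap_eq_smul_one, smul_one_eq_diagonal] using h

theorem isUnit_sub_scalar {B : Matrix (Fin m) (Fin m) F} {lam : F}
    (hB : B.charpoly.eval lam ≠ 0) : IsUnit (B - scalar (Fin m) lam) := by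
  rw [Matrix.eval_charpoly] at hB
  rw [← neg_sub, IsUnit.neg_iff, Matrix.isUnit_iff_isUnit_det]
  exact hB.isUnit

/-- A matrix intertwining `B` with `N` vanishes when `lam` is the only eigenvalue of `N` and is
not an eigenvalue of `B`. -/
theorem eq_zero_of_mul_eq_mul {N : Matrix (Fin k) (Fin k) F} {B : Matrix (Fin m) (Fin m) F}
    {lam : F} (hN : N.charpoly = (X - C lam) ^ k) (hB : B.charpoly.eval lam ≠ 0)
    {Y : Matrix (Fin k) (Fin m) F} (h : Y * B = N * Y) : Y = 0 := by
  have h1 : Y * (B - scalar (Fin m) lam) = (N - scalar (Fin k) lam) * Y := by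
    rw [Matrix.mul_sub, Matrix.sub_mul, h]
    simp [← smul_one_eq_diagonal]
  have h2 : ∀ j : ℕ, Y * (B - scalar (Fin m) lam) ^ j = (N - scalar (Fin k) lam) ^ j * Y := by
    intro j
    induction j with
    | zero => simp
    | succ j ih => rw [pow_succ, ← Matrix.mul_assoc, ih, Matrix.mul_assoc, h1,
        ← Matrix.mul_assoc, ← pow_succ]
  have h3 := h2 k
  rw [pow_sub_scalar_eq_zero hN, Matrix.zero_mul] at h3
  obtain ⟨u, hu⟩ := (isUnit_sub_scalar hB).pow k
  rw [← hu] at h3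
  have h4 := congrArg (· * (↑u⁻¹ : Matrix (Fin m) (Fin m) F)) h3
  simpa [Matrix.mul_assoc] using h4

theorem eq_zero_of_mul_eq_mul' {N : Matrix (Fin k) (Fin k) F} {B : Matrix (Fin m) (Fin m) F}
    {lam : F} (hN : N.charpoly = (X - C lam) ^ k) (hB : B.charpoly.eval lam ≠ 0)
    {Y : Matrix (Fin m) (Fin k) F} (h : Y * N = B * Y) : Y = 0 := by
  have h1 : Yᵀ * Bᵀ = Nᵀ * Yᵀ := by
    rw [← Matrix.transpose_mul, ← Matrix.transpose_mul, h]
  have h2 := eq_zero_of_mul_eq_mul (lam := lam) (by rwa [Matrix.charpoly_transpose])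
    (by rwa [Matrix.charpoly_transpose]) h1
  simpa using h2

theorem exists_conj_fromBlocks (A : Matrix (Fin k ⊕ Fin m) (Fin k ⊕ Fin m) F) (lam : F)
    (h : A.charpoly.rootMultiplicity lam = k) :
    ∃ (P : GL (Fin k ⊕ Fin m) F) (N : Matrix (Fin k) (Fin k) F) (B : Matrix (Fin m) (Fin m) F),
      N.charpoly = (X - C lam) ^ k ∧ B.charpoly.eval lam ≠ 0 ∧
        A = P.val * fromBlocks N 0 0 B * P⁻¹.val := by
  classical
  set V := Fin k ⊕ Fin m → F
  let f : Module.End F V := Matrix.toLin' A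
  have hf : f.charpoly = A.charpoly := Matrix.charpoly_toLin' A
  obtain ⟨K, hK⟩ := eventually_atTop.mp
    ((f - algebraMap F (Module.End F V) lam).eventually_isCompl_ker_pow_range_pow)
  set L := max K (Module.finrank F V) with hL
  have hc := hK L (le_max_left _ _)
  set g := f - algebraMap F (Module.End F V) lam with hg
  set p := LinearMap.ker (g ^ L)
  set r := LinearMap.range (g ^ L)
  have hcomm : Commute f (g ^ L) := by
    apply Commute.pow_right
    apply Commute.sub_right (Commute.refl f)
    exact (Algebra.commutes lam f).symm
  have hp : ∀ x ∈ p, f x ∈ p := by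
    intro x hx
    have h1 : (g ^ L) x = 0 := hx
    change (g ^ L) (f x) = 0
    have h2 := LinearMap.congr_fun hcomm.eq x
    simp only [Module.End.mul_apply] at h2
    rw [← h2, h1, map_zero]
  have hr : ∀ x ∈ r, f x ∈ r := by
    rintro x ⟨y, rfl⟩
    exact ⟨f y, (LinearMap.congr_fun hcomm.eq y).symm⟩
  have hpk : Module.finrank F p = k := by
    have h1 : p = f.maxGenEigenspace lam := by
      rw [Module.End.maxGenEigenspace_eq_genEigenspace_finrank,
        ← Module.End.genEigenspace_eq_genEigenspace_finrank_of_le f lam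
          (le_max_right K (Module.finrank F V)), Module.End.genEigenspace_nat]
      rfl
    rw [h1, LinearMap.finrank_maxGenEigenspace_eq, hf, h]
  have hrm : Module.finrank F r = m := by
    have h1 := Submodule.finrank_add_eq_of_isCompl hc
    have h2 : Module.finrank F V = k + m := by simp [V]
    change Module.finrank F p + Module.finrank F r = _ at h1
    omega
  let e := Submodule.prodEquivOfIsCompl p r hc
  let f1 := f.restrict hp
  let f2 := f.restrict hr
  let b1 := Module.finBasisOfFinrankEq F p hpk
  let b2 := Module.finBasisOfFinrankEq F r hrm
  let b0 := Pi.basisFun F (Fin k ⊕ Fin m)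
  let b := (b1.prod b2).map e
  have hconj : ∀ x, f (e x) = e ((f1.prodMap f2) x) := by
    rintro ⟨x, y⟩
    simp [e, f1, f2]
  have hM : LinearMap.toMatrix b b f =
      fromBlocks (LinearMap.toMatrix b1 b1 f1) 0 0 (LinearMap.toMatrix b2 b2 f2) := by
    rw [← LinearMap.toMatrix_prodMap]
    ext i j
    simp only [LinearMap.toMatrix_apply]
    simp only [b, Module.Basis.map_apply, hconj, Module.Basis.map_repr, LinearEquiv.trans_apply,
      LinearEquiv.symm_apply_apply]
  have hN : (LinearMap.toMatrix b1 b1 f1).charpoly = (X - C lam) ^ k := by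
    have hnil : IsNilpotent (f1 - lam • (1 : Module.End F p)) := by
      refine ⟨L, ?_⟩
      have h3 : ∀ (j : ℕ) (x : p),
          (((f1 - lam • (1 : Module.End F p)) ^ j) x : V) = (g ^ j) x := by
        intro j
        induction j with
        | zero => simp
        | succ j ih => 
          intro x
          rw [pow_succ, pow_succ, Module.End.mul_apply, Module.End.mul_apply, ih]
          simp [f1, hg]
      ext1 x
      apply Subtype.ext
      rw [h3]
      exact x.2
    have h4 := hnil.charpoly_eq_X_pow_finrank
    rw [LinearMap.charpoly_sub_smul, hpk] at h4
    have h5 := congrArg (fun s => s.comp (X - C lam)) h4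
    rw [LinearMap.charpoly_toMatrix]
    simpa [Polynomial.comp_assoc] using h5
  have hPQ : b0.toMatrix b * b.toMatrix b0 = 1 := b0.toMatrix_mul_toMatrix_flip b
  have hQP : b.toMatrix b0 * b0.toMatrix b = 1 := b.toMatrix_mul_toMatrix_flip b0
  have hA : A = b0.toMatrix b * LinearMap.toMatrix b b f * b.toMatrix b0 := by
    rw [basis_toMatrix_mul_linearMap_toMatrix_mul_basis_toMatrix]
    change A = LinearMap.toMatrix' (Matrix.toLin' A)
    simp
  refine ⟨⟨b0.toMatrix b, b.toMatrix b0, hPQ, hQP⟩, LinearMap.toMatrix b1 b1 f1,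
    LinearMap.toMatrix b2 b2 f2, hN, ?_, ?_⟩
  · have h1 : A.charpoly = (X - C lam) ^ k * (LinearMap.toMatrix b2 b2 f2).charpoly := by
      rw [← hf, ← f.charpoly_toMatrix b, hM, Matrix.charpoly_fromBlocks_zero₁₂, hN]
    rw [h1, Polynomial.rootMultiplicity_mul (h1 ▸ A.charpoly_monic.ne_zero),
      Polynomial.rootMultiplicity_X_sub_C_pow] at h
    intro h2
    have := (Polynomial.rootMultiplicity_pos (LinearMap.toMatrix b2 b2 f2).charpoly_monic.ne_zero).2
      h2
    omega
  · rw [← hM]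
    exact hA

end BlockDecomposition

section Counting

variable (F : Type*) [Field F]

/-- The number of `n × n` matrices with no eigenvalue in `S`. -/
noncomputable def cardAvoid (S : Set F) (n : ℕ) : ℕ :=
  Nat.card {A : Matrix (Fin n) (Fin n) F // ∀ t ∈ S, A.charpoly.eval t ≠ 0}

/-- The number of `n × n` matrices having `lam` as an eigenvalue of algebraic multiplicity `k` and
no eigenvalue in `S`. -/
noncomputable def cardMult (lam : F) (S : Set F) (k n : ℕ) : ℕ :=
  Nat.card {A : Matrix (Fin n) (Fin n) F //
    A.charpoly.rootMultiplicity lam = k ∧ ∀ t ∈ S, A.charpoly.eval t ≠ 0}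

/-- The number of `k × k` matrices with characteristic polynomial `(X - lam) ^ k`. -/
noncomputable def cardUnipotent (lam : F) (k : ℕ) : ℕ :=
  Nat.card {N : Matrix (Fin k) (Fin k) F // N.charpoly = (X - C lam) ^ k}

variable {F}

/-- The block diagonal embedding of `GL k × GL m`. -/
def blockGL {k m : ℕ} (g : GL (Fin k) F) (h : GL (Fin m) F) : GL (Fin k ⊕ Fin m) F where
  val := fromBlocks g.val 0 0 h.val
  inv := fromBlocks g⁻¹.val 0 0 h⁻¹.val
  val_inv := by
    rw [Matrix.fromBlocks_multiply]
    simp only [Matrix.mul_zero, Matrix.zero_mul, add_zero, zero_add, Units.mul_inv,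
      Matrix.fromBlocks_one]
  inv_val := by
    rw [Matrix.fromBlocks_multiply]
    simp only [Matrix.mul_zero, Matrix.zero_mul, add_zero, zero_add, Units.inv_mul,
      Matrix.fromBlocks_one]

theorem blockGL_injective {k m : ℕ} {g g' : GL (Fin k) F} {h h' : GL (Fin m) F}
    (e : blockGL g h = blockGL g' h') : g = g' ∧ h = h' := by
  have h1 := congrArg Units.val e
  simp only [blockGL, Matrix.fromBlocks_inj] at h1
  exact ⟨Units.ext h1.1, Units.ext h1.2.2.2⟩

theorem exists_eq_blockGL {k m : ℕ} {lam : F} (Q : GL (Fin k ⊕ Fin m) F)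
    {N N' : Matrix (Fin k) (Fin k) F} {B B' : Matrix (Fin m) (Fin m) F}
    (hN : N.charpoly = (X - C lam) ^ k) (hN' : N'.charpoly = (X - C lam) ^ k)
    (hB : B.charpoly.eval lam ≠ 0) (hB' : B'.charpoly.eval lam ≠ 0)
    (h : Q.val * fromBlocks N 0 0 B = fromBlocks N' 0 0 B' * Q.val) :
    ∃ g h, Q = blockGL g h ∧ g.val * N = N' * g.val ∧ h.val * B = B' * h.val := by
  have h' : Q⁻¹.val * fromBlocks N' 0 0 B' = fromBlocks N 0 0 B * Q⁻¹.val := by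
    have h1 : Q⁻¹.val * (Q.val * fromBlocks N 0 0 B) * Q⁻¹.val =
      Q⁻¹.val * (fromBlocks N' 0 0 B' * Q.val) * Q⁻¹.val := by rw [h]
    rw [← Matrix.mul_assoc, Units.inv_mul, Matrix.one_mul, Matrix.mul_assoc, Matrix.mul_assoc,
      Units.mul_inv, Matrix.mul_one] at h1
    exact h1.symm
  have hQ := Q.mul_inv
  have hQ' := Q.inv_mul
  obtain ⟨a, b, c, d, hq⟩ : ∃ a b c d, Q.val = fromBlocks a b c d :=
    ⟨_, _, _, _, (Matrix.fromBlocks_toBlocks _).symm⟩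
  obtain ⟨a', b', c', d', hq'⟩ : ∃ a b c d, Q⁻¹.val = fromBlocks a b c d :=
    ⟨_, _, _, _, (Matrix.fromBlocks_toBlocks _).symm⟩
  rw [hq] at h
  rw [hq'] at h'
  rw [hq, hq'] at hQ hQ'
  simp only [Matrix.fromBlocks_multiply, Matrix.mul_zero, Matrix.zero_mul, add_zero, zero_add,
    Matrix.fromBlocks_inj] at h h'
  have hb : b = 0 := eq_zero_of_mul_eq_mul hN' hB h.2.1
  have hc : c = 0 := eq_zero_of_mul_eq_mul' hN hB' h.2.2.1
  have hb' : b' = 0 := eq_zero_of_mul_eq_mul hN hB' h'.2.1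
  have hc' : c' = 0 := eq_zero_of_mul_eq_mul' hN' hB h'.2.2.1
  subst hb hc hb' hc'
  rw [Matrix.fromBlocks_multiply, ← Matrix.fromBlocks_one, Matrix.fromBlocks_inj] at hQ hQ'
  simp only [Matrix.mul_zero, Matrix.zero_mul, add_zero, zero_add] at hQ hQ'
  refine ⟨⟨a, a', hQ.1, hQ'.1⟩, ⟨d, d', hQ.2.2.2, hQ'.2.2.2⟩, Units.ext hq, h.1, h.2.2.2⟩

theorem cardMult_mul {lam : F} {S : Set F} (hlam : lam ∉ S) (k m : ℕ) :
    cardMult F lam S k (k + m) * (Nat.card (GL (Fin k) F) * Nat.card (GL (Fin m) F)) =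
      Nat.card (GL (Fin (k + m)) F) *
        (cardUnipotent F lam k * cardAvoid F (insert lam S) m) := by
  classical
  let D := {A : Matrix (Fin k ⊕ Fin m) (Fin k ⊕ Fin m) F //
    A.charpoly.rootMultiplicity lam = k ∧ ∀ t ∈ S, A.charpoly.eval t ≠ 0}
  have hD : cardMult F lam S k (k + m) = Nat.card D := by
    apply Nat.card_congr
    refine (Matrix.reindex finSumFinEquiv.symm finSumFinEquiv.symm).subtypeEquiv ?_
    intro A
    rw [Matrix.charpoly_reindex]
  have hG : Nat.card (GL (Fin (k + m)) F) = Nat.card (GL (Fin k ⊕ Fin m) F) :=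
    Nat.card_congr (Units.mapEquiv
      (Matrix.reindexAlgEquiv F F finSumFinEquiv.symm).toMulEquiv).toEquiv
  rw [hD, hG, cardUnipotent, cardAvoid, ← Nat.card_prod, ← Nat.card_prod, ← Nat.card_prod,
    ← Nat.card_prod]
  choose P N B hN hB hA using fun A : D => exists_conj_fromBlocks A.1 lam A.2.1
  have hcp : ∀ A : D, A.1.charpoly = (X - C lam) ^ k * (B A).charpoly := by
    intro A
    conv_lhs => rw [hA A]
    rw [Matrix.coe_units_inv, Matrix.charpoly_units_conj, Matrix.charpoly_fromBlocks_zero₁₂, hN]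
  let φ : D × (GL (Fin k) F × GL (Fin m) F) → GL (Fin k ⊕ Fin m) F ×
      ({N : Matrix (Fin k) (Fin k) F // N.charpoly = (X - C lam) ^ k} ×
        {A : Matrix (Fin m) (Fin m) F // ∀ t ∈ insert lam S, A.charpoly.eval t ≠ 0}) :=
    fun x => (P x.1 * (blockGL x.2.1 x.2.2)⁻¹,
      ⟨x.2.1.val * N x.1 * x.2.1⁻¹.val, by
        rw [Matrix.coe_units_inv, Matrix.charpoly_units_conj, hN]⟩,
      ⟨x.2.2.val * B x.1 * x.2.2⁻¹.val, by
        rw [Matrix.coe_units_inv, Matrix.charpoly_units_conj]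
        rintro t (rfl | ht)
        · exact hB x.1
        · have h1 := x.1.2.2 t ht
          rw [hcp, eval_mul] at h1
          exact right_ne_zero_of_mul h1⟩)
  have hrec : ∀ x, x.1.1 = (φ x).1.val * fromBlocks (φ x).2.1.1 0 0 (φ x).2.2.1 *
      (φ x).1⁻¹.val := by
    rintro ⟨A, g, h⟩
    have h1 : fromBlocks (g.val * N A * g⁻¹.val) 0 0 (h.val * B A * h⁻¹.val) =
        (blockGL g h).val * fromBlocks (N A) 0 0 (B A) * (blockGL g h)⁻¹.val := by
      change _ = fromBlocks g.val 0 0 h.val * fromBlocks (N A) 0 0 (B A) *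
        fromBlocks g⁻¹.val 0 0 h⁻¹.val
      simp only [Matrix.fromBlocks_multiply, Matrix.mul_zero, Matrix.zero_mul, add_zero, zero_add]
    simp only [φ, h1, _root_.mul_inv_rev, inv_inv, Units.val_mul]
    simp only [Matrix.mul_assoc, Units.inv_mul_cancel_left]
    rw [← Matrix.mul_assoc, ← hA A]
  apply Nat.card_congr
  apply Equiv.ofBijective φ
  constructor
  · rintro ⟨A, g, h⟩ ⟨A', g', h'⟩ e
    have hAA : A = A' := by
      apply Subtype.ext
      rw [hrec (A, g, h), hrec (A', g', h'), e]
    subst hAA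
    have h1 := congrArg Prod.fst e
    simp only [φ, mul_right_inj, _root_.inv_inj] at h1
    obtain ⟨rfl, rfl⟩ := blockGL_injective h1
    rfl
  · rintro ⟨P', ⟨N', hN'⟩, ⟨B', hB'⟩⟩
    have hcp' : (P'.val * fromBlocks N' 0 0 B' * P'⁻¹.val).charpoly =
        (X - C lam) ^ k * B'.charpoly := by
      rw [Matrix.coe_units_inv, Matrix.charpoly_units_conj, Matrix.charpoly_fromBlocks_zero₁₂, hN']
    have hB'lam : B'.charpoly.eval lam ≠ 0 := hB' lam (Set.mem_insert _ _)
    let A : D := ⟨P'.val * fromBlocks N' 0 0 B' * P'⁻¹.val, by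
      constructor
      · rw [hcp', Polynomial.rootMultiplicity_mul, Polynomial.rootMultiplicity_X_sub_C_pow,
          Polynomial.rootMultiplicity_eq_zero hB'lam, add_zero]
        exact mul_ne_zero (pow_ne_zero _ (X_sub_C_ne_zero _)) B'.charpoly_monic.ne_zero
      · intro t ht
        rw [hcp', eval_mul, eval_pow, eval_sub, eval_X, eval_C]
        refine mul_ne_zero (pow_ne_zero _ (sub_ne_zero.2 ?_)) (hB' t (Set.mem_insert_of_mem _ ht))
        rintro rfl
        exact hlam ht⟩
    have hAe : P'.val * fromBlocks N' 0 0 B' * P'⁻¹.val =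
      (P A).val * fromBlocks (N A) 0 0 (B A) * (P A)⁻¹.val := hA A
    have hinter : (P'⁻¹ * P A).val * fromBlocks (N A) 0 0 (B A) =
        fromBlocks N' 0 0 B' * (P'⁻¹ * P A).val := by
      have h1 := congrArg (fun M => P'⁻¹.val * M * (P A).val) hAe
      simp only [Matrix.mul_assoc, Units.inv_mul_cancel_left, Units.inv_mul, Matrix.mul_one] at h1
      rw [Units.val_mul, Matrix.mul_assoc, h1]
    obtain ⟨g, h, hQ, hg, hh⟩ := exists_eq_blockGL _ (hN A) hN' (hB A) hB'lam hinter
    refine ⟨(A, g, h), ?_⟩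
    simp only [φ, Prod.mk.injEq, Subtype.mk.injEq]
    refine ⟨?_, ?_, ?_⟩
    · rw [← hQ]
      group
    · rw [hg, Matrix.mul_assoc, Units.mul_inv, Matrix.mul_one]
    · rw [hh, Matrix.mul_assoc, Units.mul_inv, Matrix.mul_one]

theorem cardAvoid_singleton (lam : F) (n : ℕ) :
    cardAvoid F {lam} n = Nat.card (GL (Fin n) F) := by
  classical
  rw [cardAvoid]
  let e : Matrix (Fin n) (Fin n) F ≃ Matrix (Fin n) (Fin n) F :=
    Equiv.subLeft (scalar (Fin n) lam)
  have h : ∀ A : Matrix (Fin n) (Fin n) F,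
      (∀ t ∈ ({lam} : Set F), A.charpoly.eval t ≠ 0) ↔ IsUnit (e A) := by
    intro A
    simp [e, Matrix.eval_charpoly, Matrix.isUnit_iff_isUnit_det]
  rw [Nat.card_congr (e.subtypeEquiv h)]
  exact (Nat.card_congr (Equiv.ofBijective
    (fun u : GL (Fin n) F => (⟨u.val, u.isUnit⟩ : {A : Matrix (Fin n) (Fin n) F // IsUnit A}))
    ⟨fun a b hab => Units.ext (congrArg Subtype.val hab),
      fun ⟨A, u, hu⟩ => ⟨u, Subtype.ext hu⟩⟩)).symm

variable [Finite F]

theorem cardAvoid_eq_sum (lam : F) (S : Set F) (n : ℕ) :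
    cardAvoid F S n = ∑ k ∈ Finset.range (n + 1), cardMult F lam S k n := by
  classical
  have : Fintype F := Fintype.ofFinite F
  simp only [cardAvoid, cardMult, Nat.card_eq_fintype_card, Fintype.card_subtype]
  rw [Finset.card_eq_sum_card_fiberwise (t := Finset.range (n + 1))
    (f := fun A : Matrix (Fin n) (Fin n) F => A.charpoly.rootMultiplicity lam)]
  · apply Finset.sum_congr rfl
    intro k _
    congr 1
    ext A
    simp [and_comm]
  · intro A _
    have h := (A.charpoly.count_roots (a := lam) ▸ Multiset.count_le_card _ _).trans
      A.charpoly.card_roots'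
    rw [Matrix.charpoly_natDegree_eq_dim, Fintype.card_fin] at h
    simpa [Nat.lt_succ_iff] using h

theorem cardAvoid_empty (n : ℕ) : cardAvoid F ∅ n = Nat.card F ^ n ^ 2 := by
  have : Fintype F := Fintype.ofFinite F
  rw [cardAvoid, Nat.card_congr (Equiv.subtypeUnivEquiv (by simp))]
  change Nat.card (Fin n → Fin n → F) = _
  simp [pow_two, pow_mul]

end Counting

section GeneratingFunction

theorem exists_factor_iff {F : Type*} [Field F] {p : F[X]} {n : ℕ} (hp : p.Monic)
    (hn : p.natDegree = n + 1) (lam : F) :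
    (∃ f₀ : F[X], f₀.Monic ∧ f₀.natDegree = n ∧ (∀ t : F, f₀.eval t ≠ 0) ∧
      p = f₀ * (X - C lam)) ↔
      p.rootMultiplicity lam = 1 ∧ ∀ t ∈ ({lam}ᶜ : Set F), p.eval t ≠ 0 := by
  have hX : (X - C lam : F[X]) ≠ 0 := X_sub_C_ne_zero lam
  constructor
  · rintro ⟨f, hf, -, hft, rfl⟩
    constructor
    · rw [rootMultiplicity_mul (mul_ne_zero hf.ne_zero hX), rootMultiplicity_X_sub_C_self,
        rootMultiplicity_eq_zero (hft lam)]
    · intro t ht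
      rw [eval_mul, eval_sub, eval_X, eval_C]
      exact mul_ne_zero (hft t) (sub_ne_zero.2 ht)
  · rintro ⟨h1, h2⟩
    obtain ⟨f, rfl⟩ : X - C lam ∣ p :=
      dvd_iff_isRoot.2 ((rootMultiplicity_pos hp.ne_zero).1 (by omega))
    have hf : f.Monic := (monic_X_sub_C lam).of_mul_monic_left hp
    refine ⟨f, hf, ?_, ?_, mul_comm _ _⟩
    · rw [(monic_X_sub_C lam).natDegree_mul hf, natDegree_X_sub_C] at hn
      omega
    · intro t
      by_cases ht : t = lam
      · subst ht
        rw [rootMultiplicity_mul hp.ne_zero, rootMultiplicity_X_sub_C_self] at h1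
        intro h
        have := (rootMultiplicity_pos hf.ne_zero).2 h
        omega
      · have h3 := h2 t ht
        rw [eval_mul] at h3
        exact right_ne_zero_of_mul h3

/-- The finite product `∏ (1 - q⁻ⁱ)` over `1 ≤ i ≤ n`. -/
noncomputable def qProd (q : ℝ) (n : ℕ) : ℝ := ∏ i ∈ Finset.Icc 1 n, (1 - q⁻¹ ^ i)

theorem qProd_zero (q : ℝ) : qProd q 0 = 1 := by simp [qProd]

theorem qProd_succ (q : ℝ) (n : ℕ) : qProd q (n + 1) = qProd q n * (1 - q⁻¹ ^ (n + 1)) := by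
  rw [qProd, Finset.prod_Icc_succ_top (by omega), qProd]

theorem inv_pow_succ_lt_one {q : ℝ} (hq : 1 < q) (n : ℕ) : q⁻¹ ^ (n + 1) < 1 :=
  pow_lt_one₀ (by positivity) (inv_lt_one_of_one_lt₀ hq) (by omega)

theorem qProd_pos {q : ℝ} (hq : 1 < q) (n : ℕ) : 0 < qProd q n := by
  induction n with
  | zero => simp [qProd_zero]
  | succ n ih =>
    rw [qProd_succ]
    exact mul_pos ih (sub_pos.2 (inv_pow_succ_lt_one hq n))

/-- The absolute value of the coefficients in Euler's expansion of `∏ (1 - u / qʳ)`. -/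
noncomputable def eulerCoeff (q : ℝ) (k : ℕ) : ℝ := ∏ i ∈ Finset.range k, (q ^ (i + 1) - 1)⁻¹

theorem eulerCoeff_succ {q : ℝ} (hq : 1 < q) (k : ℕ) :
    (q ^ (k + 1) - 1) * eulerCoeff q (k + 1) = eulerCoeff q k := by
  have h : q ^ (k + 1) - 1 ≠ 0 := (sub_pos.2 (one_lt_pow₀ hq (by omega))).ne'
  rw [eulerCoeff, Finset.prod_range_succ, eulerCoeff]
  field_simp

/-- The power series expansion of `∏ (1 + u / qʳ)` over `r ≥ 1`. -/
noncomputable def eulerPos (q : ℝ) : PowerSeries ℝ := PowerSeries.mk (eulerCoeff q)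

/-- The power series expansion of `∏ (1 - u / qʳ)` over `r ≥ 1`. -/
noncomputable def eulerNeg (q : ℝ) : PowerSeries ℝ := PowerSeries.rescale (-1) (eulerPos q)

theorem eulerNeg_functional {q : ℝ} (hq : 1 < q) :
    eulerNeg q = PowerSeries.rescale q⁻¹ ((1 - PowerSeries.X) * eulerNeg q) := by
  have hq0 : q ≠ 0 := by positivity
  ext n
  rw [PowerSeries.coeff_rescale, sub_mul, one_mul, map_sub]
  cases n with
  | zero => simp
  | succ n =>
    rw [PowerSeries.coeff_succ_X_mul, eulerNeg, PowerSeries.coeff_rescale,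
      PowerSeries.coeff_rescale, eulerPos, PowerSeries.coeff_mk, PowerSeries.coeff_mk,
      ← eulerCoeff_succ hq n]
    have h : q⁻¹ ^ (n + 1) * q ^ (n + 1) = 1 := by
      rw [← mul_pow, inv_mul_cancel₀ hq0, one_pow]
    linear_combination (-(-1) ^ (n + 1) * eulerCoeff q (n + 1)) * h

/-- The power series `∑ uⁿ / ∏ (1 - q⁻ⁱ)`. -/
noncomputable def qExp (q : ℝ) : PowerSeries ℝ := PowerSeries.mk fun n => (qProd q n)⁻¹

theorem one_sub_X_mul_qExp {q : ℝ} (hq : 1 < q) :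
    (1 - PowerSeries.X) * qExp q = PowerSeries.rescale q⁻¹ (qExp q) := by
  ext n
  rw [sub_mul, one_mul, map_sub, PowerSeries.coeff_rescale]
  cases n with
  | zero => simp
  | succ n =>
    rw [PowerSeries.coeff_succ_X_mul, qExp, PowerSeries.coeff_mk, PowerSeries.coeff_mk, qProd_succ]
    have h1 := (qProd_pos hq n).ne'
    have h2 := (sub_pos.2 (inv_pow_succ_lt_one hq n)).ne'
    generalize q⁻¹ ^ (n + 1) = y at h2 ⊢
    field_simp
    ring

theorem one_sub_X_mul_qExp_mul_eulerNeg {q : ℝ} (hq : 1 < q) :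
    (1 - PowerSeries.X) * qExp q * eulerNeg q = 1 := by
  set W := (1 - PowerSeries.X) * qExp q * eulerNeg q with hW
  have h : W = PowerSeries.rescale q⁻¹ W := by
    conv_lhs => rw [hW, eulerNeg_functional hq, one_sub_X_mul_qExp hq, ← map_mul]
    rw [hW]
    congr 1
    ring
  ext n
  cases n with
  | zero =>
    have h1 : PowerSeries.constantCoeff (eulerNeg q) = 1 := by
      rw [← PowerSeries.coeff_zero_eq_constantCoeff_apply, eulerNeg, PowerSeries.coeff_rescale,
        eulerPos, PowerSeries.coeff_mk]
      simp [eulerCoeff]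
    simp [hW, qExp, h1, qProd]
  | succ n =>
    have h1 := congrArg (PowerSeries.coeff (n + 1)) h
    rw [PowerSeries.coeff_rescale] at h1
    have h2 := inv_pow_succ_lt_one hq n
    have h3 : (1 - q⁻¹ ^ (n + 1)) * PowerSeries.coeff (n + 1) W = 0 := by linarith
    rw [(mul_eq_zero.1 h3).resolve_left (by linarith), PowerSeries.coeff_one]
    simp

theorem coeff_mk_one_mul (f : PowerSeries ℝ) (n : ℕ) :
    PowerSeries.coeff n (PowerSeries.mk 1 * f) =
      ∑ k ∈ Finset.range (n + 1), PowerSeries.coeff k f := by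
  rw [mul_comm, PowerSeries.coeff_mul, Finset.Nat.sum_antidiagonal_eq_sum_range_succ_mk]
  simp

variable (F : Type*) [Field F] [Fintype F]

theorem one_lt_card_real : (1 : ℝ) < Fintype.card F := by
  exact_mod_cast Fintype.one_lt_card

theorem card_GL_eq (n : ℕ) : (Nat.card (GL (Fin n) F) : ℝ) =
    (Fintype.card F : ℝ) ^ n ^ 2 * qProd (Fintype.card F) n := by
  have hq := one_lt_card_real F
  set q : ℝ := ((Fintype.card F : ℕ) : ℝ)
  have hq0 : q ≠ 0 := by positivity
  have h1 : qProd q n = ∏ i ∈ Finset.range n, (1 - q⁻¹ ^ (n - i)) := by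
    have h2 : qProd q n = ∏ i ∈ Finset.range n, (1 - q⁻¹ ^ (i + 1)) := by
      clear_value q
      induction n with
      | zero => simp [qProd_zero]
      | succ n ih => rw [qProd_succ, ih, Finset.prod_range_succ]
    rw [h2, ← Finset.prod_range_reflect]
    apply Finset.prod_congr rfl
    intro i hi
    have := Finset.mem_range.1 hi
    congr 2
    omega
  rw [Matrix.card_GL_field, Fin.prod_univ_eq_prod_range
    (fun i => Fintype.card F ^ n - Fintype.card F ^ i) n, Nat.cast_prod, h1, pow_two, pow_mul]
  conv_rhs => rw [← Finset.card_range n, ← Finset.prod_const, Finset.card_range,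
    ← Finset.prod_mul_distrib]
  apply Finset.prod_congr rfl
  intro i hi
  have hi' := (Finset.mem_range.1 hi).le
  rw [Nat.cast_sub (Nat.pow_le_pow_right Fintype.card_pos hi'), Nat.cast_pow, Nat.cast_pow,
    mul_sub, mul_one, inv_pow, ← pow_sub₀ q hq0 (Nat.sub_le n i), Nat.sub_sub_self hi']

theorem card_GL_pos (n : ℕ) : (0 : ℝ) < Nat.card (GL (Fin n) F) := by
  rw [card_GL_eq]
  have := one_lt_card_real F
  exact mul_pos (by positivity) (qProd_pos this n)

/-- The generating function of the number of matrices with no eigenvalue in `S`. -/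
noncomputable def avoidSeries (S : Set F) : PowerSeries ℝ :=
  PowerSeries.mk fun n => (cardAvoid F S n : ℝ) / Nat.card (GL (Fin n) F)

/-- The generating function of the number of matrices with `lam` as only eigenvalue in the
algebraic closure. -/
noncomputable def unipotentSeries (lam : F) : PowerSeries ℝ :=
  PowerSeries.mk fun n => (cardUnipotent F lam n : ℝ) / Nat.card (GL (Fin n) F)

variable {F}

theorem cardMult_div {lam : F} {S : Set F} (hlam : lam ∉ S) (k m : ℕ) :
    (cardMult F lam S k (k + m) : ℝ) / Nat.card (GL (Fin (k + m)) F) =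
      PowerSeries.coeff k (unipotentSeries F lam) *
        PowerSeries.coeff m (avoidSeries F (insert lam S)) := by
  have h := congrArg (fun x : ℕ => (x : ℝ)) (cardMult_mul hlam k m)
  push_cast at h
  have h1 := (card_GL_pos F k).ne'
  have h2 := (card_GL_pos F m).ne'
  have h3 := (card_GL_pos F (k + m)).ne'
  rw [unipotentSeries, avoidSeries, PowerSeries.coeff_mk, PowerSeries.coeff_mk]
  field_simp
  linear_combination h

theorem avoidSeries_eq_mul {lam : F} {S : Set F} (hlam : lam ∉ S) :
    avoidSeries F S = unipotentSeries F lam * avoidSeries F (insert lam S) := by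
  ext n
  rw [PowerSeries.coeff_mul, avoidSeries, PowerSeries.coeff_mk, cardAvoid_eq_sum lam,
    Nat.cast_sum, Finset.sum_div, ← Finset.Nat.sum_antidiagonal_eq_sum_range_succ_mk
      (n := n) (f := fun p => (cardMult F lam S p.1 n : ℝ) / Nat.card (GL (Fin n) F))]
  apply Finset.sum_congr rfl
  rintro ⟨k, m⟩ hkm
  obtain rfl := Finset.HasAntidiagonal.mem_antidiagonal.1 hkm
  exact cardMult_div hlam k m

theorem avoidSeries_empty : avoidSeries F ∅ = qExp (Fintype.card F) := by
  ext n
  have h1 := one_lt_card_real F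
  have h2 := (qProd_pos h1 n).ne'
  rw [avoidSeries, PowerSeries.coeff_mk, qExp, PowerSeries.coeff_mk, cardAvoid_empty, card_GL_eq,
    Nat.card_eq_fintype_card]
  push_cast
  field_simp

theorem unipotentSeries_eq (lam : F) :
    unipotentSeries F lam = (1 - PowerSeries.X) * qExp (Fintype.card F) := by
  have h := avoidSeries_eq_mul (Set.notMem_empty lam)
  have h1 : avoidSeries F (insert lam ∅) = PowerSeries.mk 1 := by
    ext n
    rw [insert_empty_eq, avoidSeries, PowerSeries.coeff_mk, cardAvoid_singleton,
      div_self (card_GL_pos F n).ne', PowerSeries.coeff_mk, Pi.one_apply]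
  rw [h1, avoidSeries_empty] at h
  rw [h, mul_comm, mul_assoc, PowerSeries.mk_one_mul_one_sub_eq_one, mul_one]

theorem avoidSeries_univ :
    avoidSeries F Set.univ =
      PowerSeries.mk 1 * eulerNeg (Fintype.card F) ^ (Fintype.card F - 1) := by
  classical
  have hq := one_lt_card_real F
  set q : ℝ := ((Fintype.card F : ℕ) : ℝ)
  have h : ∀ S : Finset F, avoidSeries F (S : Set F) * ((1 - PowerSeries.X) * qExp q) ^ S.card =
      qExp q := by
    intro S
    induction S using Finset.induction_on with
    | empty => simp [avoidSeries_empty, q]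
    | insert a S ha ih =>
      rw [avoidSeries_eq_mul (lam := a) (S := (S : Set F)) (by simpa using ha),
        unipotentSeries_eq] at ih
      rw [Finset.card_insert_of_notMem ha, Finset.coe_insert]
      refine Eq.trans ?_ ih
      rw [pow_succ]
      ring
  have h1 := h Finset.univ
  rw [Finset.coe_univ, Finset.card_univ] at h1
  have h2 := one_sub_X_mul_qExp_mul_eulerNeg hq
  have h3 := PowerSeries.mk_one_mul_one_sub_eq_one ℝ
  obtain ⟨r, hr⟩ : ∃ r, Fintype.card F = r + 1 := ⟨_, (Nat.succ_pred Fintype.card_ne_zero).symm⟩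
  rw [hr, Nat.add_sub_cancel]
  rw [hr] at h1
  calc avoidSeries F Set.univ
      = avoidSeries F Set.univ * ((1 - PowerSeries.X) * qExp q * eulerNeg q) ^ (r + 1) := by
        rw [h2, one_pow, mul_one]
    _ = (avoidSeries F Set.univ * ((1 - PowerSeries.X) * qExp q) ^ (r + 1)) *
          eulerNeg q ^ (r + 1) := by rw [mul_pow _ (eulerNeg q), mul_assoc]
    _ = qExp q * eulerNeg q * eulerNeg q ^ r := by rw [h1]; ring
    _ = (PowerSeries.mk 1 * (1 - PowerSeries.X)) * (qExp q * eulerNeg q) * eulerNeg q ^ r := by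
        rw [h3, one_mul]
    _ = PowerSeries.mk 1 * ((1 - PowerSeries.X) * qExp q * eulerNeg q) * eulerNeg q ^ r := by ring
    _ = _ := by rw [h2, mul_one]

theorem alphaC1_succ (n : ℕ) :
    alphaC1 F (Fintype.card F) (n + 1) =
      (Fintype.card F : ℝ) / (Fintype.card F - 1) * (qProd (Fintype.card F) (n + 1) *
        ∑ k ∈ Finset.range (n + 1),
          PowerSeries.coeff k (eulerNeg (Fintype.card F) ^ (Fintype.card F - 1))) := by
  have hq := one_lt_card_real F
  have hcard : (Nat.card {A : Matrix (Fin (n + 1)) (Fin (n + 1)) F //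
      ∃ (lam : F) (f₀ : Polynomial F), f₀.Monic ∧ f₀.natDegree = n + 1 - 1 ∧
        (∀ t : F, f₀.eval t ≠ 0) ∧ A.charpoly = f₀ * (X - C lam)}) =
      ∑ lam : F, cardMult F lam {lam}ᶜ 1 (n + 1) := by
    simp only [cardMult]
    rw [← Nat.card_sigma]
    symm
    have hiff : ∀ (A : Matrix (Fin (n + 1)) (Fin (n + 1)) F) (lam : F),
        (A.charpoly.rootMultiplicity lam = 1 ∧ ∀ t ∈ ({lam}ᶜ : Set F), A.charpoly.eval t ≠ 0) ↔
        ∃ f₀ : F[X], f₀.Monic ∧ f₀.natDegree = n ∧ (∀ t : F, f₀.eval t ≠ 0) ∧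
          A.charpoly = f₀ * (X - C lam) := fun A lam =>
      (exists_factor_iff A.charpoly_monic
        (by rw [Matrix.charpoly_natDegree_eq_dim, Fintype.card_fin]) lam).symm
    apply Nat.card_congr
    refine Equiv.ofBijective (fun x => ⟨x.2.1, x.1, (hiff _ _).1 x.2.2⟩) ⟨?_, ?_⟩
    · rintro ⟨a, A, hA⟩ ⟨b, B, hB⟩ h
      obtain rfl : A = B := congrArg Subtype.val h
      obtain rfl : a = b := by
        by_contra hab
        have h1 := hB.2 a hab
        exact h1 ((rootMultiplicity_pos A.charpoly_monic.ne_zero).1 (by rw [hA.1]; exact one_pos))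
      rfl
    · rintro ⟨A, lam, h⟩
      exact ⟨⟨lam, A, (hiff _ _).2 h⟩, rfl⟩
  have hmult : ∀ lam : F, (cardMult F lam {lam}ᶜ 1 (n + 1) : ℝ) =
      (Fintype.card F : ℝ) ^ (n + 1) ^ 2 * (qProd (Fintype.card F) (n + 1) *
        ((Fintype.card F - 1 : ℝ)⁻¹ * ∑ k ∈ Finset.range (n + 1),
          PowerSeries.coeff k (eulerNeg (Fintype.card F) ^ (Fintype.card F - 1)))) := by
    intro lam
    have h := cardMult_div (lam := lam) (S := {lam}ᶜ) (by simp) 1 n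
    have h1 : insert lam ({lam}ᶜ : Set F) = Set.univ := by
      ext x
      simp [em]
    rw [h1, avoidSeries_univ, coeff_mk_one_mul, unipotentSeries_eq, add_comm 1 n,
      div_eq_iff (card_GL_pos F (n + 1)).ne', card_GL_eq] at h
    rw [h]
    have h2 : PowerSeries.coeff 1 ((1 - PowerSeries.X) * qExp (Fintype.card F)) =
        (Fintype.card F - 1 : ℝ)⁻¹ := by
      rw [one_sub_X_mul_qExp hq, PowerSeries.coeff_rescale, qExp, PowerSeries.coeff_mk,
        qProd_succ, qProd_zero]
      have h3 : (Fintype.card F : ℝ) - 1 ≠ 0 := by linarith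
      have h4 : (Fintype.card F : ℝ) ≠ 0 := by positivity
      rw [zero_add, pow_one, one_mul]
      field_simp
    rw [h2]
    ring
  rw [alphaC1, hcard, Nat.cast_sum, Finset.sum_congr rfl fun lam _ => hmult lam, Finset.sum_const,
    Finset.card_univ, nsmul_eq_mul]
  have h3 : (Fintype.card F : ℝ) - 1 ≠ 0 := by linarith
  have h4 : (Fintype.card F : ℝ) ≠ 0 := by positivity
  field_simp

end GeneratingFunction

section Estimates

theorem eulerCoeff_nonneg {q : ℝ} (hq : 1 < q) (k : ℕ) : 0 ≤ eulerCoeff q k :=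
  Finset.prod_nonneg fun i _ => inv_nonneg.2 (sub_pos.2 (one_lt_pow₀ hq (by omega))).le

theorem eulerCoeff_le {q : ℝ} (hq : 1 < q) (k : ℕ) :
    eulerCoeff q k ≤ (1 / (q - 1)) ^ k / (k.factorial : ℝ) := by
  have h0 : 0 < q - 1 := sub_pos.2 hq
  induction k with
  | zero => simp [eulerCoeff]
  | succ k ih =>
    have h1 := one_add_mul_sub_le_pow (a := q) (by linarith) (k + 1)
    have h2 : ((k : ℝ) + 1) * (q - 1) ≤ q ^ (k + 1) - 1 := by
      push_cast at h1
      linarith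
    have h3 : 0 < ((k : ℝ) + 1) * (q - 1) := by positivity
    rw [eulerCoeff, Finset.prod_range_succ, ← eulerCoeff, Nat.factorial_succ,
      pow_succ (1 / (q - 1)) k]
    calc eulerCoeff q k * (q ^ (k + 1) - 1)⁻¹
        ≤ (1 / (q - 1)) ^ k / (k.factorial : ℝ) * (((k : ℝ) + 1) * (q - 1))⁻¹ := by
          gcongr
          exact inv_nonneg.2 (h3.le.trans h2)
      _ = _ := by
          push_cast
          generalize (1 / (q - 1)) ^ k = y
          field_simp

/-- The function `x ↦ ∏ (1 + x / qʳ)`, given by its power series. -/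
noncomputable def eulerFun (q x : ℝ) : ℝ := ∑' k, eulerCoeff q k * x ^ k

theorem norm_eulerCoeff_mul_le {q : ℝ} (hq : 1 < q) (x : ℝ) (k : ℕ) :
    ‖eulerCoeff q k * x ^ k‖ ≤ (|x| / (q - 1)) ^ k / (k.factorial : ℝ) := by
  rw [norm_mul, Real.norm_of_nonneg (eulerCoeff_nonneg hq k), norm_pow, Real.norm_eq_abs]
  calc eulerCoeff q k * |x| ^ k ≤ (1 / (q - 1)) ^ k / (k.factorial : ℝ) * |x| ^ k := by
        gcongr
        exact eulerCoeff_le hq k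
    _ = _ := by
        rw [div_pow, div_pow, one_pow]
        ring

theorem summable_norm_euler {q : ℝ} (hq : 1 < q) (x : ℝ) :
    Summable fun k => ‖eulerCoeff q k * x ^ k‖ :=
  Summable.of_nonneg_of_le (fun _ => norm_nonneg _) (norm_eulerCoeff_mul_le hq x)
    (Real.summable_pow_div_factorial _)

theorem eulerFun_one_le {q : ℝ} (hq : 1 < q) : eulerFun q 1 ≤ Real.exp (1 / (q - 1)) := by
  rw [Real.exp_eq_exp_ℝ, NormedSpace.exp_eq_tsum_div]
  refine Summable.tsum_le_tsum (fun k => ?_) (summable_norm_euler hq 1).of_norm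
    (Real.summable_pow_div_factorial _)
  simpa using eulerCoeff_le hq k

theorem eulerFun_mul {q : ℝ} (hq : 1 < q) (x : ℝ) :
    eulerFun q (q * x) = (1 + x) * eulerFun q x := by
  have hs := (summable_norm_euler hq x).of_norm
  have hs' := (summable_norm_euler hq (q * x)).of_norm
  have h1 : eulerFun q x = 1 + ∑' k, eulerCoeff q (k + 1) * x ^ (k + 1) := by
    rw [eulerFun, hs.tsum_eq_zero_add]
    simp [eulerCoeff]
  have h2 : eulerFun q (q * x) =
      1 + ∑' k, (eulerCoeff q (k + 1) * x ^ (k + 1) + x * (eulerCoeff q k * x ^ k)) := by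
    rw [eulerFun, hs'.tsum_eq_zero_add]
    congr 1
    · simp [eulerCoeff]
    · apply tsum_congr
      intro k
      rw [← eulerCoeff_succ hq k]
      ring
  rw [h2, Summable.tsum_add ((summable_nat_add_iff 1).2 hs) (hs.mul_left x), tsum_mul_left,
    ← add_assoc, ← h1, eulerFun]
  ring

theorem sum_inv_pow_le {q : ℝ} (hq : 1 < q) (s : ℕ) :
    ∑ i ∈ Finset.range s, q⁻¹ ^ (i + 1) ≤ 1 / (q - 1) := by
  have h0 : 0 < q - 1 := sub_pos.2 hq
  have h : ∑ i ∈ Finset.range s, q⁻¹ ^ (i + 1) = 1 / (q - 1) * (1 - q⁻¹ ^ s) := by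
    induction s with
    | zero => simp
    | succ s ih =>
      rw [Finset.sum_range_succ, ih, pow_succ]
      generalize q⁻¹ ^ s = y
      field_simp
      ring
  rw [h]
  have : 0 ≤ q⁻¹ ^ s := by positivity
  exact mul_le_of_le_one_right (by positivity) (by linarith)

theorem eulerFun_pow_succ_le {q : ℝ} (hq : 1 < q) (s : ℕ) :
    eulerFun q (q ^ (s + 1)) ≤ 2 * q ^ (∑ i ∈ Finset.range (s + 1), i) *
      Real.exp (∑ i ∈ Finset.range s, q⁻¹ ^ (i + 1)) * Real.exp (1 / (q - 1)) := by
  have hq0 : 0 < q := by linarith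
  induction s with
  | zero =>
    have h := eulerFun_mul hq 1
    have h1 := eulerFun_one_le hq
    rw [mul_one] at h
    rw [zero_add, pow_one, h]
    simp only [Finset.sum_range_one, Finset.sum_range_zero, pow_zero, Real.exp_zero, mul_one]
    linarith
  | succ s ih =>
    rw [pow_succ', eulerFun_mul hq, Finset.sum_range_succ (fun i => i) (s + 1),
      Finset.sum_range_succ (fun i => q⁻¹ ^ (i + 1)) s, Real.exp_add,
      pow_add q (∑ i ∈ Finset.range (s + 1), i) (s + 1)]
    have h1 : 1 + q ^ (s + 1) ≤ q ^ (s + 1) * Real.exp (q⁻¹ ^ (s + 1)) := by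
      have h2 := Real.add_one_le_exp (q⁻¹ ^ (s + 1))
      have h3 : q ^ (s + 1) * q⁻¹ ^ (s + 1) = 1 := by
        rw [← mul_pow, mul_inv_cancel₀ hq0.ne', one_pow]
      calc 1 + q ^ (s + 1) = q ^ (s + 1) * (q⁻¹ ^ (s + 1) + 1) := by rw [mul_add, h3, mul_one]
        _ ≤ _ := by gcongr
    calc (1 + q ^ (s + 1)) * eulerFun q (q ^ (s + 1))
        ≤ (q ^ (s + 1) * Real.exp (q⁻¹ ^ (s + 1))) *
          (2 * q ^ (∑ i ∈ Finset.range (s + 1), i) *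
            Real.exp (∑ i ∈ Finset.range s, q⁻¹ ^ (i + 1)) * Real.exp (1 / (q - 1))) := by
          gcongr
          exact tsum_nonneg fun k => mul_nonneg (eulerCoeff_nonneg hq k) (by positivity)
      _ = _ := by ring

theorem eulerFun_neg_one {q c : ℝ} (hq : 1 < q) (hc : Tendsto (qProd q) atTop (nhds c)) :
    eulerFun q (-1) = c := by
  have hq0 : 0 < q := by linarith
  have h1 : ∀ M : ℕ, eulerFun q (-1) = qProd q M * eulerFun q (-q⁻¹ ^ M) := by
    intro M
    induction M with
    | zero => simp [qProd_zero]
    | succ M ih =>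
      have h2 : -q⁻¹ ^ M = q * (-q⁻¹ ^ (M + 1)) := by
        rw [pow_succ']
        field_simp
      rw [ih, h2, eulerFun_mul hq, qProd_succ]
      ring
  have h0 : eulerFun q 0 = 1 := by
    rw [eulerFun, tsum_eq_single 0 (by intro k hk; simp [hk])]
    simp [eulerCoeff]
  have hx : Tendsto (fun M : ℕ => -q⁻¹ ^ M) atTop (nhds 0) := by
    simpa using (tendsto_pow_atTop_nhds_zero_of_lt_one (inv_nonneg.2 hq0.le)
      (inv_lt_one_of_one_lt₀ hq)).neg
  have h3 : Tendsto (fun M : ℕ => eulerFun q (-q⁻¹ ^ M)) atTop (nhds 1) := by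
    rw [← h0]
    refine tendsto_tsum_of_dominated_convergence (summable_norm_euler hq 1)
      (fun k => (hx.pow k).const_mul _) (Eventually.of_forall fun M k => ?_)
    rw [norm_mul, norm_mul, norm_pow, norm_pow, norm_neg, norm_pow, norm_one, one_pow]
    refine mul_le_mul_of_nonneg_left (pow_le_one₀ (by positivity) (pow_le_one₀ (by positivity) ?_))
      (norm_nonneg _)
    rw [Real.norm_of_nonneg (inv_nonneg.2 hq0.le)]
    exact inv_le_one_of_one_le₀ hq.le
  have h4 := hc.mul h3
  rw [mul_one] at h4
  refine tendsto_nhds_unique (tendsto_const_nhds.congr fun M => ?_) h4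
  exact h1 M

theorem summable_tsum_pow_eval {f : PowerSeries ℝ} {x : ℝ}
    (hf : Summable fun k => ‖PowerSeries.coeff k f * x ^ k‖) (j : ℕ) :
    (Summable fun k => ‖PowerSeries.coeff k (f ^ j) * x ^ k‖) ∧
      ∑' k, PowerSeries.coeff k (f ^ j) * x ^ k = (∑' k, PowerSeries.coeff k f * x ^ k) ^ j := by
  induction j with
  | zero =>
    have h : ∀ k, k ∉ ({0} : Finset ℕ) → PowerSeries.coeff k (f ^ 0) * x ^ k = 0 := by
      intro k hk
      rw [pow_zero, PowerSeries.coeff_one, if_neg (by simpa using hk), zero_mul]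
    refine ⟨summable_of_ne_finset_zero (s := {0}) fun k hk => by rw [h k hk, norm_zero], ?_⟩
    rw [tsum_eq_sum h]
    simp
  | succ j ih =>
    have h : ∀ k, PowerSeries.coeff k (f ^ (j + 1)) * x ^ k =
        ∑ p ∈ Finset.HasAntidiagonal.antidiagonal k, (PowerSeries.coeff p.1 (f ^ j) * x ^ p.1) *
          (PowerSeries.coeff p.2 f * x ^ p.2) := by
      intro k
      rw [pow_succ, PowerSeries.coeff_mul, Finset.sum_mul]
      apply Finset.sum_congr rfl
      intro p hp
      rw [← Finset.HasAntidiagonal.mem_antidiagonal.1 hp, pow_add]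
      ring
    simp only [h]
    have h1 := summable_norm_sum_mul_antidiagonal_of_summable_norm ih.1 hf
    have h2 := tsum_mul_tsum_eq_tsum_sum_antidiagonal_of_summable_norm ih.1 hf
    rw [ih.2, ← pow_succ] at h2
    exact ⟨h1, h2.symm⟩

theorem coeff_eulerPos_pow_nonneg {q : ℝ} (hq : 1 < q) (r k : ℕ) :
    0 ≤ PowerSeries.coeff k (eulerPos q ^ r) := by
  induction r generalizing k with
  | zero =>
    rw [pow_zero, PowerSeries.coeff_one]
    split_ifs <;> norm_num
  | succ r ih =>
    rw [pow_succ, PowerSeries.coeff_mul]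
    refine Finset.sum_nonneg fun p _ => mul_nonneg (ih _) ?_
    rw [eulerPos, PowerSeries.coeff_mk]
    exact eulerCoeff_nonneg hq _

theorem summable_tsum_eulerPos_pow {q : ℝ} (hq : 1 < q) (x : ℝ) (r : ℕ) :
    (Summable fun k => ‖PowerSeries.coeff k (eulerPos q ^ r) * x ^ k‖) ∧
      ∑' k, PowerSeries.coeff k (eulerPos q ^ r) * x ^ k = eulerFun q x ^ r := by
  have h : (Summable fun k => ‖PowerSeries.coeff k (eulerPos q) * x ^ k‖) := by
    simpa only [eulerPos, PowerSeries.coeff_mk] using summable_norm_euler hq x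
  have h1 := summable_tsum_pow_eval h r
  refine ⟨h1.1, h1.2.trans ?_⟩
  simp only [eulerPos, PowerSeries.coeff_mk, eulerFun]

theorem coeff_eulerNeg_pow (q : ℝ) (r k : ℕ) : PowerSeries.coeff k (eulerNeg q ^ r) =
    PowerSeries.coeff k (eulerPos q ^ r) * (-1) ^ k := by
  rw [eulerNeg, ← map_pow, PowerSeries.coeff_rescale, mul_comm]

theorem hasSum_eulerNeg_pow {q c : ℝ} (hq : 1 < q) (hc : Tendsto (qProd q) atTop (nhds c))
    (r : ℕ) : HasSum (fun k => PowerSeries.coeff k (eulerNeg q ^ r)) (c ^ r) := by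
  obtain ⟨h1, h2⟩ := summable_tsum_eulerPos_pow hq (-1) r
  rw [eulerFun_neg_one hq hc] at h2
  simp only [coeff_eulerNeg_pow]
  rw [← h2]
  exact h1.of_norm.hasSum

theorem abs_tail_le {q c : ℝ} (hq : 1 < q) (hc : Tendsto (qProd q) atTop (nhds c)) (r n : ℕ)
    {R : ℝ} (hR : 1 ≤ R) :
    |c ^ r - ∑ k ∈ Finset.range n, PowerSeries.coeff k (eulerNeg q ^ r)| * R ^ n ≤
      eulerFun q R ^ r := by
  have hs := hasSum_eulerNeg_pow hq hc r
  obtain ⟨h1, h2⟩ := summable_tsum_eulerPos_pow hq R r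
  have h3 := hs.summable.sum_add_tsum_nat_add n
  rw [hs.tsum_eq] at h3
  have hb := coeff_eulerPos_pow_nonneg hq r
  have hR0 : 0 < R := by linarith
  have h4 : c ^ r - ∑ k ∈ Finset.range n, PowerSeries.coeff k (eulerNeg q ^ r) =
      ∑' k, PowerSeries.coeff (k + n) (eulerNeg q ^ r) := by linarith
  have h5 := (summable_nat_add_iff n).2 h1.of_norm
  have h6 := h1.of_norm.sum_add_tsum_nat_add n
  have h7 : 0 ≤ ∑ k ∈ Finset.range n, PowerSeries.coeff k (eulerPos q ^ r) * R ^ k :=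
    Finset.sum_nonneg fun k _ => mul_nonneg (hb k) (by positivity)
  rw [h4, ← Real.norm_eq_abs, ← h2, ← h6]
  have h8 : ‖∑' k, PowerSeries.coeff (k + n) (eulerNeg q ^ r)‖ ≤
      (∑' k, PowerSeries.coeff (k + n) (eulerPos q ^ r) * R ^ (k + n)) * (R ^ n)⁻¹ := by
    rw [← tsum_mul_right]
    refine tsum_of_norm_bounded (h5.mul_right _).hasSum fun k => ?_
    rw [coeff_eulerNeg_pow, norm_mul, norm_pow, norm_neg, norm_one, one_pow, mul_one,
      Real.norm_of_nonneg (hb _), pow_add, mul_assoc, mul_assoc, mul_inv_cancel₀ (by positivity),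
      mul_one]
    exact le_mul_of_one_le_right (hb _) (one_le_pow₀ hR)
  rw [← div_eq_mul_inv, le_div_iff₀ (by positivity)] at h8
  linarith

theorem cast_sum_range_id (t : ℕ) :
    ((∑ i ∈ Finset.range (t + 1), i : ℕ) : ℝ) = (t : ℝ) * (t + 1) / 2 := by
  induction t with
  | zero => simp
  | succ t ih =>
    rw [Finset.sum_range_succ]
    push_cast at ih ⊢
    rw [ih]
    ring

theorem abs_tail_le_rpow {q c : ℝ} (hq : 1 < q) (hc : Tendsto (qProd q) atTop (nhds c))
    {r : ℕ} (hr : 0 < r) (hqr : q = r + 1) (n : ℕ) :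
    |c ^ r - ∑ k ∈ Finset.range n, PowerSeries.coeff k (eulerNeg q ^ r)| ≤
      2 ^ r * Real.exp 2 * q ^ (-((n : ℝ) * (n + r)) / (2 * r)) := by
  have hq0 : 0 < q := by linarith
  have hr0 : (0 : ℝ) < r := by exact_mod_cast hr
  set t := n / r with ht
  have h1 := abs_tail_le hq hc r n (R := q ^ (t + 1)) (one_le_pow₀ hq.le)
  have h2 : eulerFun q (q ^ (t + 1)) ≤
      2 * q ^ (∑ i ∈ Finset.range (t + 1), i) * Real.exp (2 / r) := by
    refine (eulerFun_pow_succ_le hq t).trans ?_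
    rw [mul_assoc, ← Real.exp_add]
    have h3 := sum_inv_pow_le hq t
    have h4 : q - 1 = r := by rw [hqr]; ring
    rw [h4] at h3 ⊢
    gcongr
    calc _ ≤ 1 / (r : ℝ) + 1 / r := by gcongr
      _ = _ := by ring
  have h0 : 0 ≤ eulerFun q (q ^ (t + 1)) :=
    tsum_nonneg fun k => mul_nonneg (eulerCoeff_nonneg hq k) (by positivity)
  have h5 : eulerFun q (q ^ (t + 1)) ^ r ≤
      2 ^ r * Real.exp 2 * q ^ ((r : ℝ) * ((t : ℝ) * (t + 1) / 2)) := by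
    refine (pow_le_pow_left₀ h0 h2 r).trans_eq ?_
    rw [mul_pow, mul_pow, ← Real.exp_nat_mul, mul_div_cancel₀ _ hr0.ne', ← cast_sum_range_id,
      mul_comm (r : ℝ), Real.rpow_mul hq0.le, Real.rpow_natCast, Real.rpow_natCast]
    ring
  have h6 : (q ^ (t + 1)) ^ n = q ^ (((t : ℝ) + 1) * n) := by
    rw [← pow_mul, ← Real.rpow_natCast]
    push_cast
    rfl
  rw [h6, ← le_div_iff₀ (Real.rpow_pos_of_pos hq0 _)] at h1
  refine h1.trans ?_
  rw [div_le_iff₀ (Real.rpow_pos_of_pos hq0 _), mul_assoc _ (q ^ _ : ℝ), ← Real.rpow_add hq0]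
  refine h5.trans ?_
  gcongr
  · exact hq.le
  · obtain ⟨u, hu, hur⟩ : ∃ u : ℕ, n = r * t + u ∧ u < r :=
      ⟨n % r, (Nat.div_add_mod n r).symm, Nat.mod_lt _ hr⟩
    have hur' : (u : ℝ) ≤ r := by exact_mod_cast hur.le
    have hu0 : (0 : ℝ) ≤ u := Nat.cast_nonneg u
    have hn : (n : ℝ) = r * t + u := by rw [hu]; push_cast; rfl
    rw [hn]
    have h7 : -(((r : ℝ) * t + u) * (r * t + u + r)) / (2 * r) + ((t : ℝ) + 1) * (r * t + u) -
        r * (t * (t + 1) / 2) = u * (r - u) / (2 * r) := by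
      field_simp
      ring
    have h8 : 0 ≤ (u : ℝ) * (r - u) / (2 * r) :=
      div_nonneg (mul_nonneg hu0 (by linarith)) (by positivity)
    linarith

theorem qProd_succ_le {q : ℝ} (hq : 1 < q) (n : ℕ) : qProd q (n + 1) ≤ 1 - q⁻¹ := by
  induction n with
  | zero => rw [qProd_succ, qProd_zero, zero_add, pow_one, one_mul]
  | succ n ih =>
    rw [qProd_succ]
    have h := qProd_pos hq (n + 1)
    have h1 : 0 ≤ q⁻¹ ^ (n + 1 + 1) := by positivity
    nlinarith

theorem one_sub_le_qProd_succ {q : ℝ} (hq : 1 < q) (n : ℕ) :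
    1 - q⁻¹ - q⁻¹ ^ 2 + q⁻¹ ^ (n + 2) ≤ qProd q (n + 1) := by
  induction n with
  | zero =>
    rw [qProd_succ, qProd_zero]
    ring_nf
    rfl
  | succ n ih =>
    rw [qProd_succ]
    have h := qProd_succ_le hq n
    have h1 : 0 ≤ q⁻¹ ^ (n + 2) := by positivity
    have h2 : q⁻¹ ^ (n + 1 + 2) = q⁻¹ * q⁻¹ ^ (n + 2) := pow_succ' _ _
    rw [h2]
    have h3 : q⁻¹ ^ (n + 1 + 1) = q⁻¹ ^ (n + 2) := rfl
    rw [h3]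
    nlinarith

theorem one_sub_le_of_tendsto {q c : ℝ} (hq : 1 < q) (hc : Tendsto (qProd q) atTop (nhds c)) :
    1 - q⁻¹ - q⁻¹ ^ 2 ≤ c := by
  refine ge_of_tendsto ((tendsto_add_atTop_iff_nat 1).2 hc) (Eventually.of_forall fun n => ?_)
  have h1 : 0 ≤ q⁻¹ ^ (n + 2) := by
    have : 0 < q := by linarith
    positivity
  linarith [one_sub_le_qProd_succ hq n]

theorem qProd_antitone {q : ℝ} (hq : 1 < q) : Antitone (qProd q) := by
  refine antitone_nat_of_succ_le fun n => ?_
  rw [qProd_succ]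
  have h : 0 ≤ q⁻¹ ^ (n + 1) := by positivity
  have h1 := qProd_pos hq n
  nlinarith

theorem qProd_sub_le_of_tendsto {q c : ℝ} (hq : 2 ≤ q) (hc : Tendsto (qProd q) atTop (nhds c))
    (n : ℕ) : qProd q n - q⁻¹ ^ n ≤ c := by
  have hq1 : 1 < q := by linarith
  have hmono : Monotone fun n => qProd q n - q⁻¹ ^ n := by
    refine monotone_nat_of_le_succ fun n => ?_
    have h1 : qProd q n ≤ 1 := (qProd_antitone hq1 (Nat.zero_le n)).trans_eq (qProd_zero q)
    have h2 : 0 ≤ q⁻¹ ^ n := by positivity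
    have h3 : q⁻¹ ≤ 1 / 2 := by
      rw [inv_eq_one_div]
      exact one_div_le_one_div_of_le (by norm_num) hq
    have h4 : 0 ≤ q⁻¹ := by positivity
    rw [qProd_succ, pow_succ]
    have h5 : qProd q n * (q⁻¹ ^ n * q⁻¹) ≤ q⁻¹ ^ n * q⁻¹ :=
      mul_le_of_le_one_left (by positivity) h1
    nlinarith
  have hlim : Tendsto (fun n => qProd q n - q⁻¹ ^ n) atTop (nhds c) := by
    simpa using hc.sub (tendsto_pow_atTop_nhds_zero_of_lt_one (r := q⁻¹) (by positivity)
      (inv_lt_one_of_one_lt₀ hq1))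
  exact hmono.ge_of_tendsto hlim n

theorem exp_le_mul_pow_div {q : ℕ} (hq : 2 ≤ q) {c : ℝ}
    (hc : Tendsto (qProd q) atTop (nhds c)) :
    Real.exp (-23 / 9) ≤ (q : ℝ) * c ^ q / ((q : ℝ) - 1) := by
  have hq2 : (2 : ℝ) ≤ q := by exact_mod_cast hq
  have hlow := one_sub_le_of_tendsto (q := (q : ℝ)) (by linarith) hc
  rcases hq.eq_or_lt with rfl | hq3
  · have h1 : (8 : ℝ) ≤ Real.exp (23 / 9) := by
      have h2 : (23 / 9 : ℝ) = 1 + 1 + 5 / 9 := by norm_num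
      rw [h2, Real.exp_add, Real.exp_add]
      have h3 := Real.exp_one_gt_d9
      have h4 := Real.add_one_le_exp (5 / 9 : ℝ)
      nlinarith [mul_self_nonneg (Real.exp 1 - 2.7)]
    have h5 : Real.exp (-23 / 9) ≤ 1 / 8 := by
      rw [neg_div, Real.exp_neg, inv_eq_one_div]
      exact one_div_le_one_div_of_le (by norm_num) h1
    norm_num at hlow ⊢
    nlinarith
  · have hq3' : (3 : ℝ) ≤ q := by exact_mod_cast hq3
    set Q : ℝ := (q : ℝ)
    have hden : 0 < Q ^ 2 - Q - 1 := by nlinarith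
    have hc1 : Real.exp (-((Q + 1) / (Q ^ 2 - Q - 1))) ≤ c := by
      refine le_trans ?_ hlow
      have h1 := Real.add_one_le_exp ((Q + 1) / (Q ^ 2 - Q - 1))
      have h2 : 1 - Q⁻¹ - Q⁻¹ ^ 2 = 1 / ((Q + 1) / (Q ^ 2 - Q - 1) + 1) := by
        have h3 : (Q + 1) / (Q ^ 2 - Q - 1) + 1 = Q ^ 2 / (Q ^ 2 - Q - 1) := by
          rw [div_add_one hden.ne']
          congr 1
          ring
        have hQ : Q ≠ 0 := by linarith
        rw [h3, one_div_div]
        field_simp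
      rw [h2, Real.exp_neg, inv_eq_one_div]
      exact one_div_le_one_div_of_le (by positivity) h1
    have hc0 : 0 ≤ c := (Real.exp_pos _).le.trans hc1
    have h4 : Real.exp (-23 / 9) ≤ c ^ q := by
      refine le_trans ?_ (pow_le_pow_left₀ (Real.exp_pos _).le hc1 q)
      rw [← Real.exp_nat_mul, Real.exp_le_exp, mul_neg, ← mul_div_assoc, neg_div, neg_le_neg_iff,
        div_le_div_iff₀ hden (by norm_num)]
      change Q * (Q + 1) * 9 ≤ 23 * (Q ^ 2 - Q - 1)
      nlinarith
    refine h4.trans ?_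
    rw [le_div_iff₀ (by linarith)]
    have : 0 ≤ c ^ q := by positivity
    nlinarith

theorem two_pow_mul_exp_mul_le {r : ℕ} (hr : 0 < r) {w : ℝ} (hw0 : 0 ≤ w)
    (hw : w ≤ 1 - ((r : ℝ) + 1)⁻¹) :
    w * (2 ^ r * Real.exp 2) ≤ 1 / 2 * 16 ^ r := by
  have h16 : (16 : ℝ) ^ r = 2 ^ r * 8 ^ r := by
    rw [← mul_pow]
    norm_num
  have he : Real.exp 2 ≤ 8 := by
    have h1 : (2 : ℝ) = 1 + 1 := by norm_num
    rw [h1, Real.exp_add]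
    have h2 := Real.exp_one_lt_d9
    have h3 := Real.exp_pos 1
    nlinarith
  have hkey : w * Real.exp 2 ≤ 1 / 2 * 8 ^ r := by
    have h4 := Real.exp_pos 2
    rcases Nat.lt_or_ge 1 r with h | h
    · have h5 : (8 : ℝ) ^ 2 ≤ 8 ^ r := pow_le_pow_right₀ (by norm_num) h
      have h6 : 0 ≤ ((r : ℝ) + 1)⁻¹ := by positivity
      have h7 : w * Real.exp 2 ≤ 1 * Real.exp 2 := by
        gcongr
        linarith
      linarith
    · obtain rfl : r = 1 := by omega
      norm_num at hw ⊢
      nlinarith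
  rw [h16]
  calc w * (2 ^ r * Real.exp 2) = 2 ^ r * (w * Real.exp 2) := by ring
    _ ≤ 2 ^ r * (1 / 2 * 8 ^ r) := by gcongr
    _ = _ := by ring

end Estimates

/-- `α(n, q)` converges to `α(∞, q) = q·c(q)^q/(q−1) ≥ e^{−23/9}` as `n → ∞`, and for every
`n > 5(q−1)²`,
`|α(∞, q) − α(n+1, q)| ≤ (q/(q−1))·((1/2)·16^{q−1}·q^{−(n+1)(n+q)/(2(q−1))} + 4·q^{−(n+1)})`. -/
theorem stmt_9 (F : Type*) [Field F] [Fintype F] (q : ℕ) (hq : Fintype.card F = q) (c : ℝ)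
    (hc : Tendsto (fun n : ℕ => ∏ i ∈ Finset.Icc 1 n, (1 - ((q : ℝ))⁻¹ ^ i)) atTop (nhds c)) :
    Tendsto (fun n : ℕ => alphaC1 F q n) atTop
      (nhds ((q : ℝ) * c ^ q / ((q : ℝ) - 1))) ∧
    (q : ℝ) * c ^ q / ((q : ℝ) - 1) ≥ Real.exp (-23 / 9) ∧
    ∀ n : ℕ, 5 * (q - 1) ^ 2 < n →
      |(q : ℝ) * c ^ q / ((q : ℝ) - 1) - alphaC1 F q (n + 1)|
        ≤ ((q : ℝ) / ((q : ℝ) - 1)) *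
            ((1 / 2) * 16 ^ (q - 1) *
                (q : ℝ) ^ (-(((n : ℝ) + 1) * ((n : ℝ) + (q : ℝ))) / (2 * ((q : ℝ) - 1)))
              + 4 * ((q : ℝ))⁻¹ ^ (n + 1)) := by
  subst hq
  change Tendsto (qProd (Fintype.card F : ℝ)) atTop (nhds c) at hc
  have hq2 : 2 ≤ Fintype.card F := Fintype.one_lt_card
  obtain ⟨r, hr⟩ : ∃ r, Fintype.card F = r + 1 := ⟨Fintype.card F - 1, by omega⟩
  have hr0 : 0 < r := by omega
  have hα := alphaC1_succ (F := F)
  have hgt := one_lt_card_real F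
  have hq2' : (2 : ℝ) ≤ Fintype.card F := by exact_mod_cast hq2
  have hlow := exp_le_mul_pow_div hq2 hc
  have hqr : (Fintype.card F : ℝ) = r + 1 := by rw [hr]; push_cast; rfl
  have hr1 : Fintype.card F - 1 = r := by omega
  rw [hr1] at hα
  set Q : ℝ := (Fintype.card F : ℝ) with hQ
  have hsum := hasSum_eulerNeg_pow hgt hc r
  have hval : Q * c ^ Fintype.card F / (Q - 1) = Q / (Q - 1) * (c * c ^ r) := by
    rw [hr, pow_succ]
    ring
  refine ⟨?_, hlow, fun n _ => ?_⟩
  · rw [← tendsto_add_atTop_iff_nat 1, hval]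
    simp only [hα]
    exact (((tendsto_add_atTop_iff_nat 1).2 hc).mul
      ((tendsto_add_atTop_iff_nat 1).2 hsum.tendsto_sum_nat)).const_mul _
  · have hpre : 0 ≤ Q / (Q - 1) := div_nonneg (by linarith) (by linarith)
    rw [hval, hα, ← mul_sub, abs_mul, abs_of_nonneg hpre]
    refine mul_le_mul_of_nonneg_left ?_ hpre
    have htail := abs_tail_le_rpow hgt hc hr0 hqr (n + 1)
    have hw := qProd_succ_le hgt n
    have hw0 := (qProd_pos hgt (n + 1)).le
    have hcw := (qProd_antitone hgt).le_of_tendsto hc (n + 1)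
    have hwc := qProd_sub_le_of_tendsto hq2' hc (n + 1)
    have hc0 : 0 ≤ c := ge_of_tendsto hc (Eventually.of_forall fun m => (qProd_pos hgt m).le)
    have hinv : 0 ≤ Q⁻¹ := by positivity
    have hcr : c ^ r ≤ 1 := pow_le_one₀ hc0 (by linarith)
    have hcr0 : 0 ≤ c ^ r := by positivity
    have hexp : -(((n + 1 : ℕ) : ℝ) * ((n + 1 : ℕ) + r)) / (2 * r) =
        -(((n : ℝ) + 1) * (n + Q)) / (2 * (Q - 1)) := by
      rw [hqr]
      push_cast
      ring_nf
    rw [hexp] at htail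
    have hconst := two_pow_mul_exp_mul_le hr0 hw0 (by rwa [← hqr])
    rw [hr1]
    have hpos : 0 ≤ Q ^ (-(((n : ℝ) + 1) * (n + Q)) / (2 * (Q - 1))) :=
      Real.rpow_nonneg (by linarith) _
    generalize Q ^ (-(((n : ℝ) + 1) * (n + Q)) / (2 * (Q - 1))) = E at *
    generalize ∑ k ∈ Finset.range (n + 1), PowerSeries.coeff k (eulerNeg Q ^ r) = S at *
    generalize qProd Q (n + 1) = w at *
    have hp : 0 ≤ Q⁻¹ ^ (n + 1) := by positivity
    have h1 : c * c ^ r - w * S = w * (c ^ r - S) + (c - w) * c ^ r := by ring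
    rw [h1]
    refine (abs_add_le _ _).trans (add_le_add ?_ ?_)
    · rw [abs_mul, abs_of_nonneg hw0]
      calc w * |c ^ r - S| ≤ w * (2 ^ r * Real.exp 2 * E) := by gcongr
        _ = w * (2 ^ r * Real.exp 2) * E := by ring
        _ ≤ _ := by gcongr
    · rw [abs_mul, abs_of_nonneg hcr0, abs_of_nonpos (by linarith)]
      nlinarith
end
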